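/- arXiv:1911.03837 — 3 statements merged into one kernel-verified Lean document; each statement's English description precedes it below -/
import Mathlib

section
/- Let n ≥ 2, let Ω ⊆ ℝⁿ be an open set diffeomorphic to 𝔹ⁿ, and let (C_k)_{k∈ℕ} be a sequence of compact subsets of Ω such that: (i) for each k there is a diffeomorphism from ℝⁿ onto an open subset of ℝⁿ carrying the closed unit ball onto C_k (so C_k is diffeomorphic to the closed n-ball); (ii) C_k ⊆ int C_{k+1}; (iii) ⋃_k C_k = Ω; (iv) C_k ⊆ P_{k+1}; and (v) C_k ∖ P_k ≠ ∅. Then there exists a diffeomorphism Φ from Ω onto 𝔹ⁿ such that for every k: Φ(C_k) = B_k and Φ(P_k ∩ C_k) ∩ Γ_k = ∅. -/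
open Set Metric Filter

/-- `f` is a diffeomorphism from `s` onto `t` (subsets of Euclidean space), with
smooth inverse `g`: a smooth bijection with smooth inverse. -/
def IsDiffeoOn {n : ℕ} (f g : EuclideanSpace ℝ (Fin n) → EuclideanSpace ℝ (Fin n))
    (s t : Set (EuclideanSpace ℝ (Fin n))) : Prop :=
  Set.BijOn f s t ∧ ContDiffOn ℝ (⊤ : ℕ∞) f s ∧ ContDiffOn ℝ (⊤ : ℕ∞) g t ∧
    Set.EqOn (g ∘ f) id s ∧ Set.EqOn (f ∘ g) id t

/-- The slab `P_k = ℝ^{n-1} × [−k, k]` (last coordinate in `[−k,k]`). -/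
def Pslab (n : ℕ) (hn : 2 ≤ n) (k : ℕ) : Set (EuclideanSpace ℝ (Fin n)) :=
  {x | x (⟨n - 1, by omega⟩ : Fin n) ∈ Set.Icc (-(k : ℝ)) (k : ℝ)}

/-- The "labyrinth" barrier `Γ_k`: the sphere of radius `s k` centered at the origin,
minus the open `ε`-ball around the point `p_k = (0,…,0,(−1)^k s_k)`. -/
noncomputable def Gamma (n : ℕ) (hn : 2 ≤ n) (s : ℕ → ℝ) (ε : ℝ) (k : ℕ) :
    Set (EuclideanSpace ℝ (Fin n)) :=
  Metric.sphere (0 : EuclideanSpace ℝ (Fin n)) (s k) \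
    Metric.ball (EuclideanSpace.single (⟨n - 1, by omega⟩ : Fin n) ((-1 : ℝ) ^ k * s k)) ε


open scoped Topology NNReal ContDiff

section SupportedDiffeomorphisms

variable {E : Type*} [NormedAddCommGroup E] [InnerProductSpace ℝ E]

/-- The group of smooth diffeomorphisms of `E` that fix every point outside `S`. -/
def diffGroup (S : Set E) : Subgroup (Equiv.Perm E) where
  carrier := {f | ContDiff ℝ ∞ f ∧ ContDiff ℝ ∞ f.symm ∧ ∀ x ∉ S, f x = x}
  mul_mem' := by
    rintro f g ⟨hf, hf', hfS⟩ ⟨hg, hg', hgS⟩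
    refine ⟨hf.comp hg, hg'.comp hf', fun x hx => ?_⟩
    rw [Equiv.Perm.mul_apply, hgS x hx, hfS x hx]
  one_mem' := ⟨contDiff_id, contDiff_id, fun _ _ => rfl⟩
  inv_mem' := by
    rintro f ⟨hf, hf', hfS⟩
    refine ⟨hf', hf, fun x hx => ?_⟩
    rw [Equiv.Perm.inv_eq_iff_eq, hfS x hx]

theorem diffGroup_mono {S T : Set E} (h : S ⊆ T) : diffGroup S ≤ diffGroup T :=
  fun _ hf => ⟨hf.1, hf.2.1, fun x hx => hf.2.2 x fun hx' => hx (h hx')⟩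

theorem apply_mem_iff_of_mem_diffGroup {S T : Set E} (h : S ⊆ T) {f : Equiv.Perm E}
    (hf : f ∈ diffGroup S) (x : E) : f x ∈ T ↔ x ∈ T := by
  by_cases hx : f x = x
  · rw [hx]
  have hx1 : x ∈ S := by_contra fun h' => hx (hf.2.2 x h')
  have hx2 : f x ∈ S := by_contra fun h' => hx (f.injective (hf.2.2 _ h'))
  exact iff_of_true (h hx2) (h hx1)

/-- The homeomorphism underlying a smooth diffeomorphism. -/
def homeomorphOfMemDiffGroup {S : Set E} {f : Equiv.Perm E} (hf : f ∈ diffGroup S) : E ≃ₜ E where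
  toEquiv := f
  continuous_toFun := hf.1.continuous
  continuous_invFun := hf.2.1.continuous

/-- The group of diffeomorphisms of `E` that preserve the closed ball of radius `R`. -/
def ballDiffGroup (E : Type*) [NormedAddCommGroup E] [InnerProductSpace ℝ E] (R : ℝ) :
    Subgroup (Equiv.Perm E) where
  carrier := {f | f ∈ diffGroup univ ∧ ∀ x, f x ∈ closedBall 0 R ↔ x ∈ closedBall 0 R}
  mul_mem' := by
    rintro f g ⟨hf, hf'⟩ ⟨hg, hg'⟩
    exact ⟨mul_mem hf hg, fun x => (hf' _).trans (hg' x)⟩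
  one_mem' := ⟨one_mem _, fun _ => Iff.rfl⟩
  inv_mem' := by
    rintro f ⟨hf, hf'⟩
    refine ⟨inv_mem hf, fun x => ?_⟩
    rw [← hf' (f⁻¹ x)]
    exact iff_of_eq (congrArg (· ∈ closedBall 0 R) (f.apply_symm_apply x))

theorem diffGroup_le_ballDiffGroup {S : Set E} {R : ℝ} (h : S ⊆ ball 0 R) :
    diffGroup S ≤ ballDiffGroup E R := fun _ hf =>
  ⟨diffGroup_mono (subset_univ _) hf,
    apply_mem_iff_of_mem_diffGroup (h.trans ball_subset_closedBall) hf⟩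

/-- A diffeomorphism with compact support in `W` can be transported along a diffeomorphism from
`W` onto another open set. -/
theorem exists_mem_diffGroup_conj {W U K : Set E} (hW : IsOpen W) (hU : IsOpen U)
    (hK : IsCompact K) (hKW : K ⊆ W) {F G : E → E} (hFm : MapsTo F W U) (hGm : MapsTo G U W)
    (hF : ContDiffOn ℝ ∞ F W) (hG : ContDiffOn ℝ ∞ G U) (hGF : LeftInvOn G F W)
    (hFG : LeftInvOn F G U) {f : Equiv.Perm E} (hf : f ∈ diffGroup K) :
    ∃ f' ∈ diffGroup (F '' K), ∀ x ∈ W, f' (F x) = F (f x) := by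
  classical
  let T : Equiv.Perm E → E → E := fun g y => if y ∈ U then F (g (G y)) else y
  have hTU : ∀ g : Equiv.Perm E, ∀ y ∈ U, T g y = F (g (G y)) := fun g y hy => if_pos hy
  have hTU' : ∀ g : Equiv.Perm E, ∀ y ∉ U, T g y = y := fun g y hy => if_neg hy
  have hTF : ∀ g : Equiv.Perm E, ∀ x ∈ W, T g (F x) = F (g x) := fun g x hx => by
    rw [hTU g _ (hFm hx), hGF hx]
  have hTK : ∀ g ∈ diffGroup K, ∀ y ∉ F '' K, T g y = y := by
    intro g hg y hy
    by_cases hyU : y ∈ U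
    · have : G y ∉ K := fun h => hy ⟨G y, h, hFG hyU⟩
      rw [hTU g y hyU, hg.2.2 _ this, hFG hyU]
    · exact hTU' g y hyU
  have hinv : ∀ g ∈ diffGroup K, ∀ y, T g⁻¹ (T g y) = y := by
    intro g hg y
    by_cases hyU : y ∈ U
    · have hmem : g (G y) ∈ W := (apply_mem_iff_of_mem_diffGroup hKW hg _).2 (hGm hyU)
      rw [hTU g y hyU, hTF _ _ hmem]
      simp [hFG hyU]
    · rw [hTU' g y hyU, hTU' _ y hyU]
  have hsmooth : ∀ g ∈ diffGroup K, ContDiff ℝ ∞ (T g) := by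
    intro g hg
    refine contDiff_iff_contDiffAt.2 fun y => ?_
    by_cases hyU : y ∈ U
    · have h1 : ContDiffAt ℝ ∞ (fun y => F (g (G y))) y := by
        have hmem : g (G y) ∈ W := (apply_mem_iff_of_mem_diffGroup hKW hg _).2 (hGm hyU)
        have hFa : ContDiffAt ℝ ∞ F (g (G y)) := hF.contDiffAt (hW.mem_nhds hmem)
        have hGa : ContDiffAt ℝ ∞ G y := hG.contDiffAt (hU.mem_nhds hyU)
        exact hFa.comp y (hg.1.contDiffAt.comp y hGa)
      refine h1.congr_of_eventuallyEq ?_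
      filter_upwards [hU.mem_nhds hyU] with z hz using hTU g z hz
    · have hcl : IsClosed (F '' K) := (hK.image_of_continuousOn
        (hF.continuousOn.mono hKW)).isClosed
      have hy : y ∉ F '' K := by
        rintro ⟨x, hx, rfl⟩
        exact hyU (hFm (hKW hx))
      refine contDiffAt_id.congr_of_eventuallyEq ?_
      filter_upwards [hcl.isOpen_compl.mem_nhds hy] with z hz using hTK g hg z hz
  have hf' := inv_mem hf
  refine ⟨⟨T f, T f⁻¹, hinv f hf, ?_⟩, ⟨hsmooth f hf, hsmooth _ hf', hTK f hf⟩, hTF f⟩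
  simpa [Function.RightInverse, Function.LeftInverse] using hinv _ hf'

/-- A linear map that agrees near `0` with a diffeomorphism preserving the closed ball of
radius `R`. -/
def IsBallGerm (R : ℝ) (A : E →L[ℝ] E) : Prop :=
  ∃ L ∈ ballDiffGroup E R, ∀ᶠ x in 𝓝 0, L x = A x

theorem IsBallGerm.mul {R : ℝ} {A B : E →L[ℝ] E} (hA : IsBallGerm R A) (hB : IsBallGerm R B) :
    IsBallGerm R (A * B) := by
  obtain ⟨L, hL, hLA⟩ := hA
  obtain ⟨M, hM, hMB⟩ := hB
  refine ⟨L * M, mul_mem hL hM, ?_⟩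
  have : Tendsto B (𝓝 0) (𝓝 0) := by simpa using B.continuous.tendsto 0
  filter_upwards [hMB, this.eventually hLA] with x h1 h2
  rw [Equiv.Perm.mul_apply, h1, h2]
  rfl

theorem isBallGerm_one (R : ℝ) : IsBallGerm R (1 : E →L[ℝ] E) :=
  ⟨1, one_mem _, Eventually.of_forall fun _ => rfl⟩

theorem IsBallGerm.pow {R : ℝ} {A : E →L[ℝ] E} (hA : IsBallGerm R A) (N : ℕ) :
    IsBallGerm R (A ^ N) := by
  induction N with
  | zero => simpa using isBallGerm_one R
  | succ N ih => rw [pow_succ]; exact ih.mul hA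

theorem isBallGerm_of_involutive_of_norm {A : E →L[ℝ] E} (hA : A * A = 1)
    (hnorm : ∀ x, ‖A x‖ = ‖x‖) (R : ℝ) : IsBallGerm R A := by
  have hinv : Function.Involutive A := fun x => congrArg (fun B : E →L[ℝ] E => B x) hA
  refine ⟨hinv.toPerm, ⟨⟨A.contDiff, A.contDiff, fun x hx => (hx trivial).elim⟩, fun x => ?_⟩,
    Eventually.of_forall fun _ => rfl⟩
  rw [mem_closedBall_zero_iff, mem_closedBall_zero_iff]
  exact iff_of_eq (congrArg (· ≤ R) (hnorm x))

variable [FiniteDimensional ℝ E]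

/-- A smooth perturbation of the identity with Lipschitz constant less than one is a
diffeomorphism. -/
theorem exists_mem_diffGroup_eq_add {u : E → E} (hu : ContDiff ℝ ∞ u) {c : ℝ≥0} (hc : c < 1)
    (hl : LipschitzWith c u) :
    ∃ f ∈ diffGroup (Function.support u), ∀ x, f x = x + u x := by
  have happ : ApproximatesLinearOn (fun x => x + u x)
      ((ContinuousLinearEquiv.refl ℝ E : E ≃L[ℝ] E) : E →L[ℝ] E) univ c := by
    intro x _ y _
    have := hl.norm_sub_le x y
    have h2 : x + u x - (y + u y) - (x - y) = u x - u y := by abel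
    simpa [h2] using this
  have hcN : Subsingleton E ∨
      c < ‖((ContinuousLinearEquiv.refl ℝ E).symm : E →L[ℝ] E)‖₊⁻¹ := by
    rcases subsingleton_or_nontrivial E with h | h
    · exact Or.inl h
    · refine Or.inr ?_
      have : ‖((ContinuousLinearEquiv.refl ℝ E).symm : E →L[ℝ] E)‖₊ = 1 := by
        ext
        exact ContinuousLinearMap.norm_id
      rwa [this, inv_one]
  let e : E ≃ₜ E := happ.toHomeomorph _ hcN
  have he : ∀ x, e x = x + u x := fun _ => rfl
  have hsm : ContDiff ℝ ∞ e := contDiff_id.add hu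
  have hnorm : ∀ x, ‖-fderiv ℝ u x‖ < 1 := fun x => by
    rw [norm_neg]
    exact (norm_fderiv_le_of_lipschitz ℝ hl).trans_lt (by exact_mod_cast hc)
  have hsymm : ContDiff ℝ ∞ e.symm := by
    refine e.contDiff_symm
      (f₀' := fun x => ContinuousLinearEquiv.unitsEquiv ℝ E (Units.oneSub _ (hnorm x)))
      (fun x => ?_) hsm
    have h1 : HasFDerivAt u (fderiv ℝ u x) x :=
      ((hu.differentiable (by simp)) x).hasFDerivAt
    have h2 := (hasFDerivAt_id x).add h1
    have h3 : ((ContinuousLinearEquiv.unitsEquiv ℝ E (Units.oneSub _ (hnorm x)) : E ≃L[ℝ] E) :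
        E →L[ℝ] E) = ContinuousLinearMap.id ℝ E + fderiv ℝ u x := by
      ext y
      simp
    rw [h3]
    exact h2
  refine ⟨e.toEquiv, ⟨hsm, hsymm, fun x hx => ?_⟩, he⟩
  have : u x = 0 := by simpa using hx
  change e x = x
  rw [he, this, add_zero]

theorem exists_bump_of_isCompact {D U : Set E} (hD : IsCompact D) (hU : IsOpen U) (hDU : D ⊆ U) :
    ∃ χ : E → ℝ, ContDiff ℝ ∞ χ ∧ HasCompactSupport χ ∧ tsupport χ ⊆ U ∧ ∀ x ∈ D, χ x = 1 := by
  obtain ⟨K, hK, hDK, hKU⟩ := exists_compact_between hD hU hDU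
  obtain ⟨f, hf1, hf0, -⟩ := exists_contMDiffMap_one_nhds_of_subset_interior
    (n := ⊤) (modelWithCornersSelf ℝ E) hD.isClosed hDK
  have hsub : tsupport f ⊆ K := closure_minimal
    (fun x hx => by_contra fun h => hx (hf0 x h)) hK.isClosed
  exact ⟨f, f.contMDiff.contDiff, hK.of_isClosed_subset (isClosed_tsupport _) hsub,
    hsub.trans hKU, fun x hx => hf1.self_of_nhdsSet x hx⟩

/-- A compact convex set can be contracted to one of its points by an arbitrarily strong
homothety, through a diffeomorphism supported in a compact part of a given neighbourhood. -/
theorem exists_mem_diffGroup_homothety {D U : Set E} (hD : IsCompact D) (hconv : Convex ℝ D)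
    (hU : IsOpen U) (hDU : D ⊆ U) {m : E} (hm : m ∈ D) {η : ℝ} (hη : 0 < η) :
    ∃ K, IsCompact K ∧ K ⊆ U ∧ ∃ f ∈ diffGroup K, ∃ t, 0 < t ∧ t < η ∧
      ∀ x ∈ D, f x = m + t • (x - m) := by
  obtain ⟨χ, hχ, hχc, hχU, hχ1⟩ := exists_bump_of_isCompact hD hU hDU
  have hv : ContDiff ℝ ∞ (fun x => χ x • (x - m)) := hχ.smul (contDiff_id.sub contDiff_const)
  have hvc : HasCompactSupport (fun x => χ x • (x - m)) := hχc.smul_right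
  obtain ⟨C, hC⟩ := hv.lipschitzWith_of_hasCompactSupport hvc (by simp)
  set δ : ℝ≥0 := (2 * (C + 1))⁻¹ with hδ
  have hδ0 : 0 < δ := by positivity
  have hδ2 : δ < 1 := by
    rw [hδ]
    refine inv_lt_one_of_one_lt₀ ?_
    have : (0 : ℝ≥0) ≤ C := zero_le
    calc (1 : ℝ≥0) < 2 * 1 := by norm_num
      _ ≤ 2 * (C + 1) := by gcongr; exact le_add_of_nonneg_left this
  have hlip : LipschitzWith (δ * C) (fun x => (-(δ : ℝ)) • (χ x • (x - m))) := by
    have := (lipschitzWith_smul (β := E) (-(δ : ℝ))).comp hC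
    simpa [Function.comp_def] using this
  have hlt : δ * C < 1 := by
    rw [hδ, inv_mul_lt_iff₀ (by positivity), mul_one, two_mul]
    calc C < C + 1 := lt_add_one C
      _ ≤ C + 1 + (C + 1) := le_add_of_nonneg_right zero_le
  obtain ⟨f, hf, hfx⟩ := exists_mem_diffGroup_eq_add (hv.const_smul (-(δ : ℝ))) hlt hlip
  have hsub : Function.support (fun x => (-(δ : ℝ)) • (χ x • (x - m))) ⊆ tsupport χ := by
    intro x hx
    refine subset_tsupport _ fun h => hx ?_
    simp [h]
  have hδ0' : (0 : ℝ) < δ := by exact_mod_cast hδ0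
  have hδ2' : (δ : ℝ) < 1 := by exact_mod_cast hδ2
  obtain ⟨N, hN⟩ := exists_pow_lt_of_lt_one hη (y := 1 - (δ : ℝ)) (by linarith)
  have hiter : ∀ N : ℕ, ∀ x ∈ D, (f ^ N) x = m + (1 - (δ : ℝ)) ^ N • (x - m) := by
    intro N
    induction N with
    | zero => intro x _; simp
    | succ N ih =>
      intro x hx
      have hmem : m + (1 - (δ : ℝ)) ^ N • (x - m) ∈ D :=
        hconv.add_smul_sub_mem hm hx ⟨by positivity,
          pow_le_one₀ (by linarith) (by linarith)⟩
      rw [pow_succ', Equiv.Perm.mul_apply, ih x hx, hfx, hχ1 _ hmem]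
      module
  exact ⟨tsupport χ, hχc, hχU, f ^ N, pow_mem (diffGroup_mono hsub hf) N, _,
    pow_pos (by linarith) N, hN, hiter N⟩

/-- Diffeomorphisms supported in a connected open set act transitively on it. -/
theorem exists_mem_diffGroup_apply_eq {U : Set E} (hU : IsOpen U) (hc : IsPreconnected U)
    {p q : E} (hp : p ∈ U) (hq : q ∈ U) : ∃ f ∈ diffGroup U, f p = q := by
  refine hc.induction₂ (fun p q => ∃ f ∈ diffGroup U, f p = q) ?_ ?_ ?_ hp hq
  · intro x hx
    obtain ⟨χ, hχ, hχc, hχU, hχ1⟩ :=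
      exists_bump_of_isCompact isCompact_singleton hU (singleton_subset_iff.2 hx)
    obtain ⟨C, hC⟩ := hχ.lipschitzWith_of_hasCompactSupport hχc (by simp)
    have hev : ∀ᶠ y in 𝓝 x, C * ‖y - x‖₊ < 1 := by
      have : Tendsto (fun y => C * ‖y - x‖₊) (𝓝 x) (𝓝 (C * ‖x - x‖₊)) :=
        Continuous.tendsto (by fun_prop) x
      exact this.eventually_lt_const (by simp)
    filter_upwards [nhdsWithin_le_nhds hev] with y hy
    have hlip : LipschitzWith (C * ‖y - x‖₊) (fun z => χ z • (y - x)) := by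
      refine LipschitzWith.of_dist_le_mul fun a b => ?_
      have := hC.dist_le_mul a b
      rw [dist_eq_norm, ← sub_smul, norm_smul]
      rw [dist_eq_norm] at this
      calc ‖χ a - χ b‖ * ‖y - x‖ ≤ (C * dist a b) * ‖y - x‖ := by gcongr
        _ = _ := by push_cast; ring
    have hsm : ContDiff ℝ ∞ (fun z => χ z • (y - x)) := hχ.smul contDiff_const
    obtain ⟨f, hf, hfx⟩ := exists_mem_diffGroup_eq_add hsm hy hlip
    have hsub : Function.support (fun z => χ z • (y - x)) ⊆ U := fun z hz =>
      hχU (subset_tsupport _ fun h => hz (by simp [h]))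
    refine ⟨f, diffGroup_mono hsub hf, ?_⟩
    rw [hfx, hχ1 x rfl]
    simp
  · rintro x y z - - - ⟨f, hf, rfl⟩ ⟨g, hg, rfl⟩
    exact ⟨g * f, mul_mem hg hf, rfl⟩
  · rintro x y - - ⟨f, hf, rfl⟩
    exact ⟨f⁻¹, inv_mem hf, by simp⟩


/-- A smooth map tangent to the identity at the fixed point `0` agrees near `0` with a
diffeomorphism supported in an arbitrarily small ball. -/
theorem exists_mem_diffGroup_eventuallyEq {G : E → E} (hG : ContDiff ℝ ∞ G) (hG0 : G 0 = 0)
    (hG' : HasFDerivAt G (ContinuousLinearMap.id ℝ E) 0) {R : ℝ} (hR : 0 < R) :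
    ∃ f ∈ diffGroup (ball (0 : E) R), ∀ᶠ x in 𝓝 0, f x = G x := by
  obtain ⟨χ, hχ, hχc, hχU, hχ1⟩ := exists_bump_of_isCompact
    (isCompact_closedBall (0 : E) 1) isOpen_ball (closedBall_subset_ball (one_lt_two))
  obtain ⟨C, hC⟩ := hχ.lipschitzWith_of_hasCompactSupport hχc (by simp)
  obtain ⟨B, hB⟩ := hχ.continuous.bounded_above_of_compact_support hχc
  have hB0 : 0 ≤ B := (norm_nonneg _).trans (hB 0)
  have hχ0 : ∀ x, 2 ≤ ‖x‖ → χ x = 0 := fun x hx => by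
    by_contra h
    have := hχU (subset_tsupport _ h)
    rw [mem_ball_zero_iff] at this
    linarith
  set ε : ℝ≥0 := (2 * (⟨B, hB0⟩ + 2 * C + 1))⁻¹ with hε
  have hε0 : 0 < ε := by positivity
  have hstrict : HasStrictFDerivAt G (ContinuousLinearMap.id ℝ E) 0 := by
    have := hG.hasStrictFDerivAt (x := 0) (by simp)
    rwa [hG'.fderiv] at this
  obtain ⟨V, hV, happ⟩ := hstrict.approximates_deriv_on_nhds (c := ε) (Or.inr hε0)
  obtain ⟨ρ, hρ, hρV⟩ := Metric.mem_nhds_iff.1 hV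
  obtain ⟨t, ht0, htρ, htR⟩ : ∃ t : ℝ, 0 < t ∧ 2 * t < ρ ∧ 2 * t < R :=
    ⟨min ρ R / 4, by positivity, by have := min_le_left ρ R; linarith,
      by have := min_le_right ρ R; linarith⟩
  set g : E → E := fun x => G x - x with hg
  have hglip : ∀ x y, ‖x‖ ≤ 2 * t → ‖y‖ ≤ 2 * t → ‖g x - g y‖ ≤ ε * ‖x - y‖ := by
    intro x y hx hy
    have := happ x (hρV (mem_ball_zero_iff.2 (hx.trans_lt htρ))) y
      (hρV (mem_ball_zero_iff.2 (hy.trans_lt htρ)))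
    have h2 : g x - g y = G x - G y - (x - y) := by simp only [hg]; abel
    rw [h2]
    exact this
  have hgbd : ∀ x, ‖x‖ ≤ 2 * t → ‖g x‖ ≤ ε * (2 * t) := by
    intro x hx
    have := hglip x 0 hx (by rw [norm_zero]; positivity)
    simp only [hg, hG0, sub_zero] at this ⊢
    exact this.trans (by gcongr)
  set u : E → E := fun x => χ (t⁻¹ • x) • g x with hu
  have hχt : ∀ x, 2 * t ≤ ‖x‖ → χ (t⁻¹ • x) = 0 := fun x hx => by
    refine hχ0 _ ?_
    rw [norm_smul, norm_inv, Real.norm_of_nonneg ht0.le, inv_mul_eq_div, le_div_iff₀ ht0]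
    exact hx
  have hχlip : ∀ x y, ‖χ (t⁻¹ • x) - χ (t⁻¹ • y)‖ ≤ C * t⁻¹ * ‖x - y‖ := fun x y => by
    have := hC.norm_sub_le (t⁻¹ • x) (t⁻¹ • y)
    rwa [← smul_sub, norm_smul, norm_inv, Real.norm_of_nonneg ht0.le, ← mul_assoc] at this
  have hhalf : (ε : ℝ) * (B + 2 * C) ≤ 1 / 2 := by
    have : (ε : ℝ) = (2 * (B + 2 * C + 1))⁻¹ := by rw [hε]; push_cast; rfl
    rw [this, inv_mul_le_iff₀ (by positivity)]
    nlinarith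
  have hcut : ∀ x y, ‖x‖ ≤ 2 * t → ‖(χ (t⁻¹ • x) - χ (t⁻¹ • y)) • g x‖ ≤
      ε * (2 * C) * ‖x - y‖ := by
    intro x y hx
    rw [norm_smul]
    calc _ ≤ (C * t⁻¹ * ‖x - y‖) * (ε * (2 * t)) := by gcongr; exacts [hχlip x y, hgbd x hx]
      _ = _ := by field_simp
  have hεB : 0 ≤ (ε : ℝ) * B := by positivity
  have hone : ∀ x y, ‖x‖ ≤ 2 * t → ‖u x - u y‖ ≤ 1 / 2 * ‖x - y‖ := by
    intro x y hx
    rcases le_total (‖y‖) (2 * t) with hy | hy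
    · have h1 : u x - u y = (χ (t⁻¹ • x) - χ (t⁻¹ • y)) • g x + χ (t⁻¹ • y) • (g x - g y) := by
        simp only [hu]; module
      rw [h1]
      refine (norm_add_le _ _).trans ?_
      have h2 : ‖χ (t⁻¹ • y) • (g x - g y)‖ ≤ B * (ε * ‖x - y‖) := by
        rw [norm_smul]
        gcongr
        exacts [hB _, hglip x y hx hy]
      nlinarith [hcut x y hx, norm_nonneg (x - y)]
    · have h1 : u x - u y = (χ (t⁻¹ • x) - χ (t⁻¹ • y)) • g x := by
        simp only [hu, hχt y hy]; module
      rw [h1]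
      nlinarith [hcut x y hx, norm_nonneg (x - y)]
  have hlip : LipschitzWith (1 / 2) u := by
    refine LipschitzWith.of_dist_le_mul fun x y => ?_
    rw [dist_eq_norm, dist_eq_norm]
    push_cast
    rcases le_total (‖x‖) (2 * t) with hx | hx
    · exact hone x y hx
    rcases le_total (‖y‖) (2 * t) with hy | hy
    · rw [norm_sub_rev, norm_sub_rev x]
      exact hone y x hy
    · simp only [hu, hχt x hx, hχt y hy, zero_smul, sub_self, norm_zero]
      positivity
  have husm : ContDiff ℝ ∞ u :=
    (hχ.comp (contDiff_id.const_smul t⁻¹)).smul (hG.sub contDiff_id)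
  obtain ⟨f, hf, hfx⟩ := exists_mem_diffGroup_eq_add husm
    (show (1 / 2 : ℝ≥0) < 1 from half_lt_self one_pos) hlip
  have hsub : Function.support u ⊆ ball 0 R := by
    intro x hx
    rw [mem_ball_zero_iff]
    by_contra! h
    exact hx (by simp only [hu, hχt x (htR.le.trans h), zero_smul])
  refine ⟨f, diffGroup_mono hsub hf, ?_⟩
  filter_upwards [closedBall_mem_nhds (0 : E) ht0] with x hx
  have : χ (t⁻¹ • x) = 1 := by
    refine hχ1 _ ?_
    rw [mem_closedBall_zero_iff] at hx ⊢
    rw [norm_smul, norm_inv, Real.norm_of_nonneg ht0.le, inv_mul_eq_div, div_le_one ht0]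
    exact hx
  rw [hfx, hu]
  simp [this, hg]

theorem eventually_isBallGerm {R : ℝ} (hR : 0 < R) :
    ∀ᶠ A in 𝓝 (1 : E →L[ℝ] E), IsBallGerm R A := by
  obtain ⟨χ, hχ, hχc, hχU, hχ1⟩ := exists_bump_of_isCompact
    (isCompact_closedBall (0 : E) (R / 2)) isOpen_ball (closedBall_subset_ball (half_lt_self hR))
  have hv : ContDiff ℝ ∞ (fun x => χ x • x) := hχ.smul contDiff_id
  obtain ⟨C, hC⟩ := hv.lipschitzWith_of_hasCompactSupport hχc.smul_right (by simp)
  have hev : ∀ᶠ A in 𝓝 (1 : E →L[ℝ] E), ‖A - 1‖₊ * C < 1 := by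
    have : Tendsto (fun A : E →L[ℝ] E => ‖A - 1‖₊ * C) (𝓝 1) (𝓝 (‖(1 : E →L[ℝ] E) - 1‖₊ * C)) :=
      Continuous.tendsto (by fun_prop) 1
    exact this.eventually_lt_const (by simp)
  filter_upwards [hev] with A hA
  have hsm : ContDiff ℝ ∞ (fun x => (A - 1) (χ x • x)) := (A - 1).contDiff.comp hv
  obtain ⟨f, hf, hfx⟩ := exists_mem_diffGroup_eq_add hsm hA ((A - 1).lipschitz.comp hC)
  have hsub : Function.support (fun x => (A - 1) (χ x • x)) ⊆ ball 0 R := fun x hx =>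
    hχU (subset_tsupport _ fun h => hx (by simp [h]))
  refine ⟨f, diffGroup_le_ballDiffGroup hsub hf, ?_⟩
  filter_upwards [closedBall_mem_nhds (0 : E) (half_pos hR)] with x hx
  rw [hfx, hχ1 x hx]
  simp

end SupportedDiffeomorphisms

section LinearGerms

variable {n : ℕ}

theorem isBallGerm_of_oneParameterGroup {R : ℝ} (hR : 0 < R)
    {γ : ℝ → Matrix (Fin n) (Fin n) ℝ} (hγ : Continuous γ) (h0 : γ 0 = 1)
    (hadd : ∀ s t, γ (s + t) = γ s * γ t) :
    IsBallGerm R (Matrix.toEuclideanCLM (𝕜 := ℝ) (γ 1)) := by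
  have hlin : Continuous (Matrix.toEuclideanCLM (n := Fin n) (𝕜 := ℝ)) :=
    LinearMap.continuous_of_finiteDimensional
      (Matrix.toEuclideanCLM (n := Fin n) (𝕜 := ℝ)).toAlgEquiv.toLinearMap
  have htend : Tendsto (fun N : ℕ => Matrix.toEuclideanCLM (𝕜 := ℝ) (γ (1 / ((N : ℝ) + 1))))
      atTop (𝓝 1) := by
    have h1 := ((hlin.comp hγ).tendsto 0).comp tendsto_one_div_add_atTop_nhds_zero_nat
    simpa [Function.comp_def, h0] using h1
  obtain ⟨N, hN⟩ := (htend.eventually (eventually_isBallGerm hR)).exists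
  have hpow : ∀ (t : ℝ) (k : ℕ), γ (k * t) = γ t ^ k := by
    intro t k
    induction k with
    | zero => simp [h0]
    | succ k ih => rw [pow_succ, ← ih, ← hadd]; congr 1; push_cast; ring
  have := hN.pow (N + 1)
  rw [← map_pow, ← hpow] at this
  convert this using 3
  push_cast
  field_simp

theorem isBallGerm_of_det_ne_zero {R : ℝ} (hR : 0 < R) (M : Matrix (Fin n) (Fin n) ℝ)
    (hM : M.det ≠ 0) : IsBallGerm R (Matrix.toEuclideanCLM (𝕜 := ℝ) M) := by
  refine Matrix.diagonal_transvection_induction_of_det_ne_zero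
    (fun M => IsBallGerm R (Matrix.toEuclideanCLM (𝕜 := ℝ) M)) M hM ?_ ?_ ?_
  · intro D hD
    have hD0 : ∀ i, D i ≠ 0 := by
      rw [Matrix.det_diagonal] at hD
      exact fun i => Finset.prod_ne_zero_iff.1 hD i (Finset.mem_univ i)
    have hpos := isBallGerm_of_oneParameterGroup hR
      (γ := fun t : ℝ => Matrix.diagonal fun i => Real.exp (t * Real.log |D i|))
      (Continuous.matrix_diagonal (by fun_prop)) (by simp)
      (fun s t => by simp [add_mul, Real.exp_add])
    have hsq : ∀ i, ((SignType.sign (D i) : ℝ)) * (SignType.sign (D i) : ℝ) = 1 := fun i => by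
      rcases lt_or_gt_of_ne (hD0 i) with h | h <;> simp [sign_neg, sign_pos, h]
    have hsign : IsBallGerm R (Matrix.toEuclideanCLM (𝕜 := ℝ)
        (Matrix.diagonal fun i => (SignType.sign (D i) : ℝ))) := by
      refine isBallGerm_of_involutive_of_norm ?_ (fun x => ?_) R
      · rw [← map_mul, Matrix.diagonal_mul_diagonal]
        simp [hsq]
      · rw [EuclideanSpace.norm_eq, EuclideanSpace.norm_eq]
        congr 1
        refine Finset.sum_congr rfl fun i _ => ?_
        rw [Matrix.ofLp_toEuclideanCLM, Matrix.mulVec_diagonal, norm_mul, mul_pow,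
          Real.norm_eq_abs (SignType.sign (D i) : ℝ), sq_abs, pow_two, hsq, one_mul]
    have := hsign.mul hpos
    rw [← map_mul, Matrix.diagonal_mul_diagonal] at this
    convert this using 3
    ext i
    rw [one_mul, Real.exp_log (abs_pos.2 (hD0 i)), sign_mul_abs]
  · intro t
    have := isBallGerm_of_oneParameterGroup hR (γ := fun s => Matrix.transvection t.i t.j (s * t.c))
      (by
        refine continuous_matrix fun a b => ?_
        simp only [Matrix.transvection, Matrix.add_apply, Matrix.single_apply]
        split_ifs <;> fun_prop) (by simp)
      (fun s u => by rw [Matrix.transvection_mul_transvection_same _ _ t.hij, add_mul])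
    simpa [Matrix.TransvectionStruct.toMatrix] using this
  · intro A B _ _ hA hB
    rw [map_mul]
    exact hA.mul hB

theorem isBallGerm_of_continuousLinearEquiv {R : ℝ} (hR : 0 < R)
    (A : EuclideanSpace ℝ (Fin n) ≃L[ℝ] EuclideanSpace ℝ (Fin n)) :
    IsBallGerm R (A : EuclideanSpace ℝ (Fin n) →L[ℝ] EuclideanSpace ℝ (Fin n)) := by
  set e := Matrix.toEuclideanCLM (n := Fin n) (𝕜 := ℝ)
  have h1 : e.symm A * e.symm A.symm = 1 := by
    rw [← map_mul, ← map_one e.symm]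
    congr 1
    ext x
    simp
  have h2 := isBallGerm_of_det_ne_zero hR (e.symm A) fun h => by
    have := congrArg Matrix.det h1
    simp [h] at this
  rwa [e.apply_symm_apply] at h2

end LinearGerms

section DiscTheorem

variable {n : ℕ}

theorem isDiffeoOn_of_mem_diffGroup {S : Set (EuclideanSpace ℝ (Fin n))}
    {f : Equiv.Perm (EuclideanSpace ℝ (Fin n))} (hf : f ∈ diffGroup S) :
    IsDiffeoOn f f.symm univ univ :=
  ⟨f.bijective.bijOn_univ, hf.1.contDiffOn, hf.2.1.contDiffOn, fun x _ => f.symm_apply_apply x,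
    fun x _ => f.apply_symm_apply x⟩

theorem exists_equiv_hasFDerivAt {F G : EuclideanSpace ℝ (Fin n) → EuclideanSpace ℝ (Fin n)}
    {U : Set (EuclideanSpace ℝ (Fin n))} (hU : IsOpen U) (h : IsDiffeoOn F G univ U)
    (x : EuclideanSpace ℝ (Fin n)) :
    ∃ A : EuclideanSpace ℝ (Fin n) ≃L[ℝ] EuclideanSpace ℝ (Fin n),
      HasFDerivAt F (A : EuclideanSpace ℝ (Fin n) →L[ℝ] EuclideanSpace ℝ (Fin n)) x := by
  obtain ⟨hbij, hF, hG, hGF, hFG⟩ := h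
  have hFx : F x ∈ U := hbij.mapsTo (mem_univ x)
  have hGFx : G (F x) = x := hGF (mem_univ x)
  have h1 : HasFDerivAt F (fderiv ℝ F x) x :=
    ((contDiffOn_univ.1 hF).differentiable (by simp) x).hasFDerivAt
  have h2 : HasFDerivAt G (fderiv ℝ G (F x)) (F x) :=
    ((hG.contDiffAt (hU.mem_nhds hFx)).differentiableAt (by simp)).hasFDerivAt
  have h3 := h2.comp x h1
  have h1' : HasFDerivAt F (fderiv ℝ F x) (G (F x)) := by rwa [hGFx]
  have h4 := h1'.comp (F x) h2
  have e3 : (fderiv ℝ G (F x)).comp (fderiv ℝ F x) = ContinuousLinearMap.id ℝ _ :=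
    h3.unique ((hasFDerivAt_id x).congr_of_eventuallyEq
      (Eventually.of_forall fun y => hGF (mem_univ y)))
  have e4 : (fderiv ℝ F x).comp (fderiv ℝ G (F x)) = ContinuousLinearMap.id ℝ _ :=
    h4.unique ((hasFDerivAt_id (F x)).congr_of_eventuallyEq
      (by filter_upwards [hU.mem_nhds hFx] with y hy using hFG hy))
  exact ⟨ContinuousLinearEquiv.equivOfInverse _ _
    (fun y => congrArg (fun B : EuclideanSpace ℝ (Fin n) →L[ℝ] EuclideanSpace ℝ (Fin n) => B y) e3)
    (fun y => congrArg (fun B : EuclideanSpace ℝ (Fin n) →L[ℝ] EuclideanSpace ℝ (Fin n) => B y) e4),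
    h1⟩

/-- Disc theorem in a ball: a smooth open embedding carrying a closed ball into an open ball
agrees on it with a diffeomorphism of the whole space preserving the larger closed ball.
This is the case of an embedding fixing the origin. -/
theorem exists_mem_ballDiffGroup_eqOn_of_map_zero
    {F G : EuclideanSpace ℝ (Fin n) → EuclideanSpace ℝ (Fin n)}
    {U : Set (EuclideanSpace ℝ (Fin n))} (hU : IsOpen U) (h : IsDiffeoOn F G univ U)
    (hF0 : F 0 = 0) {ρ R : ℝ} (hρ : 0 < ρ) (hρR : ρ < R)
    (hFR : MapsTo F (closedBall 0 ρ) (ball 0 R)) :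
    ∃ K ∈ ballDiffGroup (EuclideanSpace ℝ (Fin n)) R, EqOn K F (closedBall 0 ρ) := by
  have hR : 0 < R := hρ.trans hρR
  obtain ⟨A, hA⟩ := exists_equiv_hasFDerivAt hU h 0
  obtain ⟨L, hL, hLA⟩ := isBallGerm_of_continuousLinearEquiv hR A
  obtain ⟨hbij, hF, hG, hGF, hFG⟩ := h
  have hFs : ContDiff ℝ ∞ F := contDiffOn_univ.1 hF
  obtain ⟨k, hk, hkF⟩ := exists_mem_diffGroup_eventuallyEq (G := fun x => A.symm (F x))
    (A.symm.contDiff.comp hFs) (by simp [hF0])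
    (by
      have := A.symm.hasFDerivAt.comp (0 : EuclideanSpace ℝ (Fin n)) hA
      rwa [A.coe_symm_comp_coe] at this) hR
  have hkt : Tendsto k (𝓝 0) (𝓝 0) := by
    have h1 : k 0 = 0 := by simpa [hF0] using hkF.self_of_nhds
    simpa [h1] using hk.1.continuous.tendsto 0
  have hev : ∀ᶠ x in 𝓝 0, F x = L (k x) := by
    filter_upwards [hkF, hkt.eventually hLA] with x h1 h2
    rw [h2, h1]
    simp
  obtain ⟨η, hη, hηF⟩ := Metric.eventually_nhds_iff_ball.1 hev
  have hW : IsOpen (ball 0 R ∩ F ⁻¹' ball 0 R) :=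
    isOpen_ball.inter (isOpen_ball.preimage hFs.continuous)
  have hDW : closedBall 0 ρ ⊆ ball 0 R ∩ F ⁻¹' ball 0 R :=
    subset_inter (closedBall_subset_ball hρR) hFR
  have hη' : 0 < η / (ρ + 1) := by positivity
  have hm : (0 : EuclideanSpace ℝ (Fin n)) ∈ closedBall 0 ρ := mem_closedBall_self hρ.le
  obtain ⟨S, hS, hSU, c, hc, t, ht0, htη, hct⟩ := exists_mem_diffGroup_homothety
    (isCompact_closedBall 0 ρ) (convex_closedBall 0 ρ) hW hDW hm hη'
  obtain ⟨c', hc', hcc'⟩ := exists_mem_diffGroup_conj isOpen_univ hU hS (subset_univ _)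
    hbij.mapsTo (mapsTo_univ _ _) hF hG hGF hFG hc
  have hc'R : F '' S ⊆ ball 0 R := by
    rintro _ ⟨x, hx, rfl⟩
    exact (hSU hx).2
  refine ⟨c'⁻¹ * L * k * c, mul_mem (mul_mem (mul_mem (inv_mem
    (diffGroup_le_ballDiffGroup hc'R hc')) hL) (diffGroup_le_ballDiffGroup subset_rfl hk))
    (diffGroup_le_ballDiffGroup (fun x hx => (hSU hx).1) hc), fun x hx => ?_⟩
  have hcx : c x ∈ ball 0 η := by
    rw [hct x hx, zero_add, sub_zero, mem_ball_zero_iff, norm_smul, Real.norm_of_nonneg ht0.le]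
    rw [mem_closedBall_zero_iff] at hx
    calc t * ‖x‖ ≤ t * (ρ + 1) := by gcongr; linarith
      _ < η := (lt_div_iff₀ (by linarith)).1 htη
  simp only [Equiv.Perm.mul_apply]
  rw [Equiv.Perm.inv_eq_iff_eq, ← hηF _ hcx, hcc' x (mem_univ x)]

/-- Disc theorem in a ball: a smooth open embedding carrying a closed ball into an open ball
agrees on it with a diffeomorphism of the whole space preserving the larger closed ball. -/
theorem exists_mem_ballDiffGroup_eqOn
    {F G : EuclideanSpace ℝ (Fin n) → EuclideanSpace ℝ (Fin n)}
    {U : Set (EuclideanSpace ℝ (Fin n))} (hU : IsOpen U) (h : IsDiffeoOn F G univ U)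
    {ρ R : ℝ} (hρ : 0 < ρ) (hρR : ρ < R) (hFR : MapsTo F (closedBall 0 ρ) (ball 0 R)) :
    ∃ K ∈ ballDiffGroup (EuclideanSpace ℝ (Fin n)) R, EqOn K F (closedBall 0 ρ) := by
  obtain ⟨g, hg, hg0⟩ := exists_mem_diffGroup_apply_eq isOpen_ball
    (convex_ball (0 : EuclideanSpace ℝ (Fin n)) R).isPreconnected
    (mem_ball_self (hρ.trans hρR)) (hFR (mem_closedBall_self hρ.le))
  obtain ⟨hbij, hF, hG, hGF, hFG⟩ := h
  obtain ⟨K, hK, hKF⟩ := exists_mem_ballDiffGroup_eqOn_of_map_zero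
    (F := fun x => g.symm (F x)) (G := fun x => G (g x)) (U := g ⁻¹' U)
    (hU.preimage hg.1.continuous)
    ⟨⟨fun x _ => by simpa using hbij.mapsTo (mem_univ x),
      (g.symm.injective.comp (injOn_univ.1 hbij.injOn)).injOn, fun y hy => by
        obtain ⟨x, hx, hxy⟩ := hbij.surjOn hy
        exact ⟨x, hx, by simp [hxy]⟩⟩,
      hg.2.1.comp_contDiffOn hF, hG.comp hg.1.contDiffOn fun x hx => hx,
      fun x hx => by simpa using hGF hx,
      fun y hy => by
        have : F (G (g y)) = g y := hFG hy
        simp [this]⟩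
    (by simp [← hg0]) hρ hρR
    (fun x hx => by
      rw [← apply_mem_iff_of_mem_diffGroup subset_rfl hg]
      simpa using hFR hx)
  refine ⟨g * K, mul_mem (diffGroup_le_ballDiffGroup subset_rfl hg) hK, fun x hx => ?_⟩
  rw [Equiv.Perm.mul_apply, hKF hx]
  simp

/-- A smoothly embedded closed ball is the image of a round ball under a diffeomorphism of the
whole space. -/
theorem exists_mem_diffGroup_image_closedBall
    {F G : EuclideanSpace ℝ (Fin n) → EuclideanSpace ℝ (Fin n)}
    {U : Set (EuclideanSpace ℝ (Fin n))} (hU : IsOpen U) (h : IsDiffeoOn F G univ U)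
    {ρ : ℝ} (hρ : 0 < ρ) :
    ∃ H ∈ diffGroup univ, H '' closedBall 0 ρ = F '' closedBall 0 1 := by
  obtain ⟨hbij, hF, hG, hGF, hFG⟩ := h
  have hF' : ContDiff ℝ ∞ (fun x => F (ρ⁻¹ • x)) :=
    (contDiffOn_univ.1 hF).comp (contDiff_id.const_smul _)
  obtain ⟨R, hR⟩ := (((isCompact_closedBall (0 : EuclideanSpace ℝ (Fin n)) ρ).image
    hF'.continuous).isBounded).subset_ball 0
  obtain ⟨H, hH, hHF⟩ := exists_mem_ballDiffGroup_eqOn (F := fun x => F (ρ⁻¹ • x))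
    (G := fun y => ρ • G y) hU
    ⟨⟨fun x _ => hbij.mapsTo (mem_univ _), fun x _ y _ hxy =>
        smul_right_injective _ (inv_ne_zero hρ.ne') (hbij.injOn (mem_univ _) (mem_univ _) hxy),
      fun y hy => by
        obtain ⟨x, -, hxy⟩ := hbij.surjOn hy
        exact ⟨ρ • x, mem_univ _, by simp [smul_smul, hρ.ne', hxy]⟩⟩,
      hF'.contDiffOn, hG.const_smul ρ,
      fun x _ => by
        have : G (F (ρ⁻¹ • x)) = ρ⁻¹ • x := hGF (mem_univ _)
        simp [this, smul_smul, hρ.ne'],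
      fun y hy => by
        have : F (G y) = y := hFG hy
        simp [smul_smul, hρ.ne', this]⟩
    hρ (R := max R (ρ + 1)) (lt_max_of_lt_right (lt_add_one ρ))
    (fun x hx => ball_subset_ball (le_max_left _ _) (hR (mem_image_of_mem _ hx)))
  refine ⟨H, hH.1, ?_⟩
  rw [hHF.image_eq, ← image_image F, image_smul, smul_closedBall _ _ hρ.le]
  simp [abs_of_pos hρ, hρ.ne']

end DiscTheorem

section Cap

variable {E : Type*} [NormedAddCommGroup E] [InnerProductSpace ℝ E]

/-- The inversion of `E` in the unit sphere around `c`. -/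
noncomputable def unitInversion (c x : E) : E := c + (‖x - c‖ ^ 2)⁻¹ • (x - c)

theorem norm_unitInversion_sub (c x : E) : ‖unitInversion c x - c‖ = ‖x - c‖⁻¹ := by
  rw [unitInversion, add_sub_cancel_left, norm_smul, norm_inv, norm_pow, norm_norm]
  rcases eq_or_ne (‖x - c‖) 0 with h | h
  · simp [h]
  · field_simp

theorem unitInversion_ne {c x : E} (h : x ≠ c) : unitInversion c x ≠ c := by
  rw [← sub_ne_zero, ← norm_ne_zero_iff, norm_unitInversion_sub]
  exact inv_ne_zero (norm_ne_zero_iff.2 (sub_ne_zero.2 h))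

theorem unitInversion_unitInversion {c x : E} (h : x ≠ c) :
    unitInversion c (unitInversion c x) = x := by
  have h0 : ‖x - c‖ ≠ 0 := norm_ne_zero_iff.2 (sub_ne_zero.2 h)
  rw [unitInversion, norm_unitInversion_sub, unitInversion, add_sub_cancel_left, smul_smul,
    inv_pow, inv_inv, mul_inv_cancel₀ (pow_ne_zero 2 h0), one_smul, add_sub_cancel]

theorem contDiffOn_unitInversion (c : E) : ContDiffOn ℝ ∞ (unitInversion c) {c}ᶜ := by
  have h1 : ContDiff ℝ ∞ (fun x : E => x - c) := contDiff_id.sub contDiff_const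
  have h2 : ContDiffOn ℝ ∞ (fun x : E => (‖x - c‖ ^ 2)⁻¹) {c}ᶜ :=
    (h1.norm_sq ℝ).contDiffOn.inv fun x hx =>
      pow_ne_zero 2 (norm_ne_zero_iff.2 (sub_ne_zero.2 hx))
  exact contDiffOn_const.add (h2.smul h1.contDiffOn)

/-- Inversion in a point `c` of a sphere centred at the origin turns the sphere minus a ball
around `c` into a flat disc. -/
theorem unitInversion_mem_disc {c x : E} (hx : ‖x‖ = ‖c‖) {ε : ℝ} (hε : 0 < ε)
    (hxε : ε ≤ ‖x - c‖) :
    unitInversion c x ∈ {y | inner ℝ (y - c) c = -(1 / 2)} ∩ closedBall c ε⁻¹ := by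
  have h0 : ‖x - c‖ ≠ 0 := (hε.trans_le hxε).ne'
  have h1 : ‖x - c‖ ^ 2 = -(2 * inner ℝ (x - c) c) := by
    have := norm_add_sq_real (x - c) c
    rw [sub_add_cancel, hx] at this
    linarith
  constructor
  · rw [mem_ofPred_eq, unitInversion, add_sub_cancel_left, real_inner_smul_left, inv_mul_eq_iff_eq_mul₀
      (pow_ne_zero 2 h0), h1]
    ring
  · rw [mem_closedBall, dist_eq_norm, norm_unitInversion_sub]
    gcongr

theorem unitInversion_mem_cap {c y : E} {ε : ℝ} (hε : 0 < ε)
    (hy : y ∈ {y | inner ℝ (y - c) c = -(1 / 2)} ∩ closedBall c ε⁻¹) :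
    y ≠ c ∧ unitInversion c y ∈ sphere 0 ‖c‖ \ ball c ε := by
  obtain ⟨h1, h2⟩ := hy
  rw [mem_ofPred_eq] at h1
  have hne : y ≠ c := by
    rintro rfl
    norm_num at h1
  have h0 : 0 < ‖y - c‖ := norm_pos_iff.2 (sub_ne_zero.2 hne)
  refine ⟨hne, ?_, ?_⟩
  · have h3 := norm_add_sq_real (unitInversion c y - c) c
    rw [sub_add_cancel, norm_unitInversion_sub, unitInversion, add_sub_cancel_left,
      real_inner_smul_left, h1] at h3
    rw [mem_sphere_zero_iff_norm, unitInversion]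
    refine (sq_eq_sq₀ (norm_nonneg _) (norm_nonneg _)).1 (h3.trans ?_)
    rw [inv_pow]
    ring
  · rw [mem_closedBall, dist_eq_norm] at h2
    rw [mem_ball, dist_eq_norm, norm_unitInversion_sub, not_lt]
    exact (le_inv_comm₀ hε h0).2 h2

/-- A sphere minus a ball around one of its points can be moved into any nonempty open subset of a
connected neighbourhood by a diffeomorphism supported in that neighbourhood. -/
theorem exists_mem_diffGroup_mapsTo_cap [FiniteDimensional ℝ E] {U V : Set E} {c q : E} {ε : ℝ}
    (hε : 0 < ε) (hU : IsOpen U) (hUc : IsPreconnected U) (hV : IsOpen V) (hqU : q ∈ U)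
    (hqV : q ∈ V) (hcap : sphere 0 ‖c‖ \ ball c ε ⊆ U) :
    ∃ h ∈ diffGroup U, MapsTo h (sphere 0 ‖c‖ \ ball c ε) V := by
  rcases (sphere 0 ‖c‖ \ ball c ε).eq_empty_or_nonempty with hemp | ⟨p, hp⟩
  · exact ⟨1, one_mem _, by rw [hemp]; exact mapsTo_empty _ _⟩
  set D : Set E := {y | inner ℝ (y - c) c = -(1 / 2)} ∩ closedBall c ε⁻¹ with hDdef
  have hJD : ∀ x ∈ sphere 0 ‖c‖ \ ball c ε, x ≠ c ∧ unitInversion c x ∈ D := by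
    rintro x ⟨hx1, hx2⟩
    rw [mem_ball, dist_eq_norm, not_lt] at hx2
    refine ⟨?_, unitInversion_mem_disc (mem_sphere_zero_iff_norm.1 hx1) hε hx2⟩
    rintro rfl
    rw [sub_self, norm_zero] at hx2
    exact hx2.not_gt hε
  have hDcompact : IsCompact D := by
    refine (isCompact_closedBall c ε⁻¹).inter_left (isClosed_eq ?_ continuous_const)
    fun_prop
  have hDconv : Convex ℝ D := by
    refine Convex.inter ?_ (convex_closedBall c ε⁻¹)
    intro x hx y hy a b _ _ hab
    rw [mem_ofPred_eq] at hx hy ⊢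
    have : a • x + b • y - c = a • (x - c) + b • (y - c) := by
      rw [eq_sub_of_add_eq hab]
      module
    rw [this, inner_add_left, real_inner_smul_left, real_inner_smul_left, hx, hy, ← add_mul, hab,
      one_mul]
  obtain ⟨g, hg, hgp⟩ := exists_mem_diffGroup_apply_eq hU hUc (hcap hp) hqU
  have hopen : ∀ T : Set E, IsOpen T → IsOpen ({c}ᶜ ∩ unitInversion c ⁻¹' T) := fun T hT =>
    (contDiffOn_unitInversion c).continuousOn.isOpen_inter_preimage isOpen_compl_singleton hT
  obtain ⟨hpc, hm⟩ := hJD p hp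
  have hmV : unitInversion c p ∈ {c}ᶜ ∩ unitInversion c ⁻¹' (g ⁻¹' V) := by
    refine ⟨unitInversion_ne hpc, ?_⟩
    rw [mem_preimage, mem_preimage, unitInversion_unitInversion hpc, hgp]
    exact hqV
  obtain ⟨η, hη, hηV⟩ := Metric.isOpen_iff.1 (hopen _ (hV.preimage hg.1.continuous)) _ hmV
  obtain ⟨B, hB⟩ := hDcompact.isBounded.subset_closedBall (unitInversion c p)
  have hB0 : 0 ≤ B := dist_nonneg.trans (hB hm)
  have hη' : 0 < η / (B + 1) := by positivity
  have hDU : D ⊆ {c}ᶜ ∩ unitInversion c ⁻¹' U := fun y hy =>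
    ⟨(unitInversion_mem_cap hε hy).1, hcap (unitInversion_mem_cap hε hy).2⟩
  obtain ⟨K, hK, hKU, f, hf, t, ht0, htη, hft⟩ :=
    exists_mem_diffGroup_homothety hDcompact hDconv (hopen U hU) hDU hm hη'
  have hmaps : MapsTo (unitInversion c) {c}ᶜ {c}ᶜ := fun x hx => unitInversion_ne hx
  have hinv : LeftInvOn (unitInversion c) (unitInversion c) {c}ᶜ := fun x hx =>
    unitInversion_unitInversion hx
  obtain ⟨f', hf', hff'⟩ := exists_mem_diffGroup_conj isOpen_compl_singleton
    isOpen_compl_singleton hK (fun x hx => (hKU hx).1) hmaps hmaps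
    (contDiffOn_unitInversion c) (contDiffOn_unitInversion c) hinv hinv hf
  have hKU' : unitInversion c '' K ⊆ U := by
    rintro _ ⟨x, hx, rfl⟩
    exact (hKU hx).2
  refine ⟨g * f', mul_mem hg (diffGroup_mono hKU' hf'), fun x hx => ?_⟩
  obtain ⟨hxc, hxD⟩ := hJD x hx
  have h1 := hff' _ (unitInversion_ne hxc)
  rw [unitInversion_unitInversion hxc] at h1
  rw [Equiv.Perm.mul_apply, h1]
  refine (hηV ?_).2
  rw [hft _ hxD, mem_ball, dist_eq_norm, add_sub_cancel_left, norm_smul,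
    Real.norm_of_nonneg ht0.le]
  have h2 := hB hxD
  rw [mem_closedBall, dist_eq_norm] at h2
  calc _ ≤ t * (B + 1) := by gcongr; linarith
    _ < η := (lt_div_iff₀ (by linarith)).1 htη

theorem isPreconnected_annulus (h : 1 < Module.rank ℝ E) {a : ℝ} (ha : 0 ≤ a) (b : ℝ) :
    IsPreconnected {x : E | a < ‖x‖ ∧ ‖x‖ < b} := by
  have h1 := ((isPreconnected_Ioo (a := a) (b := b)).prod
    (isPreconnected_sphere h (0 : E) 1)).image (fun z : ℝ × E => z.1 • z.2)
    (by fun_prop)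
  convert h1
  ext x
  constructor
  · rintro ⟨hx1, hx2⟩
    have hx0 : 0 < ‖x‖ := ha.trans_lt hx1
    refine ⟨(‖x‖, ‖x‖⁻¹ • x), ⟨⟨hx1, hx2⟩, ?_⟩, ?_⟩
    · rw [mem_sphere_zero_iff_norm, norm_smul, norm_inv, norm_norm, inv_mul_cancel₀ hx0.ne']
    · simp [smul_smul, hx0.ne']
  · rintro ⟨⟨t, y⟩, ⟨⟨ht1, ht2⟩, hy⟩, rfl⟩
    rw [mem_sphere_zero_iff_norm] at hy
    simp only at ht1 ht2 hy
    simp [norm_smul, hy, abs_of_nonneg (ha.trans ht1.le), ht1, ht2]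

end Cap

section Gluing

variable {E : Type*} [NormedAddCommGroup E] [InnerProductSpace ℝ E]

theorem exists_contDiffOn_iUnion_eqOn {A : ℕ → Set E} (hA : ∀ k, A k ⊆ interior (A (k + 1)))
    {g : ℕ → E → E} (hg : ∀ k, ContDiff ℝ ∞ (g k)) (hcompat : ∀ k, EqOn (g (k + 1)) (g k) (A k)) :
    ∃ f : E → E, ContDiffOn ℝ ∞ f (⋃ k, A k) ∧ ∀ k, EqOn f (g k) (A k) := by
  classical
  have hmono : Monotone A := monotone_nat_of_le_succ fun k => (hA k).trans interior_subset
  have hle : ∀ k m, k ≤ m → EqOn (g m) (g k) (A k) := by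
    intro k m hkm
    induction m, hkm using Nat.le_induction with
    | base => exact fun _ _ => rfl
    | succ m hkm ih => exact fun x hx => (hcompat m (hmono hkm hx)).trans (ih hx)
  let f : E → E := fun x => if h : ∃ k, x ∈ A k then g (Nat.find h) x else x
  have hf : ∀ k, EqOn f (g k) (A k) := by
    intro k x hx
    have h : ∃ k, x ∈ A k := ⟨k, hx⟩
    have h1 : f x = g (Nat.find h) x := dif_pos h
    rw [h1]
    exact (hle _ _ (Nat.find_min' h hx) (Nat.find_spec h)).symm
  refine ⟨f, fun x hx => ?_, hf⟩
  obtain ⟨k, hk⟩ := mem_iUnion.1 hx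
  refine ContDiffAt.contDiffWithinAt ?_
  refine (hg (k + 1)).contDiffAt.congr_of_eventuallyEq ?_
  filter_upwards [isOpen_interior.mem_nhds (hA k hk)] with y hy using hf _ (interior_subset hy)

theorem image_closedBall_of_mem_ballDiffGroup {R : ℝ} {f : Equiv.Perm E}
    (hf : f ∈ ballDiffGroup E R) : f '' closedBall 0 R = closedBall 0 R := by
  ext x
  rw [f.image_eq_preimage_symm, mem_preimage, ← hf.2, f.apply_symm_apply]

theorem image_interior_eq_ball {f : Equiv.Perm E} {S C : Set E} (hf : f ∈ diffGroup S) {R : ℝ}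
    (hR : 0 < R) (hC : f '' C = closedBall 0 R) : f '' interior C = ball 0 R := by
  have h := (homeomorphOfMemDiffGroup hf).image_interior C
  change f '' interior C = interior (f '' C) at h
  rw [h, hC, interior_closedBall _ hR.ne']

theorem subset_closure_interior {f : Equiv.Perm E} {S C : Set E} (hf : f ∈ diffGroup S) {R : ℝ}
    (hR : 0 < R) (hC : f '' C = closedBall 0 R) : C ⊆ closure (interior C) := by
  have h := (homeomorphOfMemDiffGroup hf).image_closure (interior C)
  change f '' closure (interior C) = closure (f '' interior C) at h
  rw [image_interior_eq_ball hf hR hC, closure_ball _ hR.ne', ← hC] at h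
  exact (f.injective.image_injective h).ge

/-- A diffeomorphism can be corrected on an open connected set so that a closed set not containing
`C` is moved off the punctured sphere. -/
theorem exists_mem_diffGroup_image_inter_cap_eq_empty [FiniteDimensional ℝ E]
    {f : Equiv.Perm E} {S C P U : Set E} {c : E} {R ε : ℝ} (hf : f ∈ diffGroup S) (hR : 0 < R)
    (hC : f '' C = closedBall 0 R) (hP : IsClosed P) (hCP : (C \ P).Nonempty) (hε : 0 < ε)
    (hU : IsOpen U) (hUc : IsPreconnected U) (hCU : f '' (interior C \ P) ⊆ U)
    (hcap : sphere 0 ‖c‖ \ ball c ε ⊆ U) :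
    ∃ h ∈ diffGroup U, (h * f) '' (P ∩ C) ∩ (sphere 0 ‖c‖ \ ball c ε) = ∅ := by
  obtain ⟨x, hxC, hxP⟩ := hCP
  obtain ⟨q, hqP, hqC⟩ := mem_closure_iff.1 (subset_closure_interior hf hR hC hxC) _
    hP.isOpen_compl hxP
  have hV : IsOpen (f '' (interior C \ P)) :=
    (homeomorphOfMemDiffGroup hf).isOpenMap _ (isOpen_interior.sdiff hP)
  have hqV : f q ∈ f '' (interior C \ P) := mem_image_of_mem f ⟨hqC, hqP⟩
  obtain ⟨h, hh, hmaps⟩ :=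
    exists_mem_diffGroup_mapsTo_cap hε hU hUc hV (hCU hqV) hqV hcap
  refine ⟨h⁻¹, inv_mem hh, eq_empty_of_forall_notMem ?_⟩
  rintro _ ⟨⟨z, ⟨hzP, -⟩, rfl⟩, hz⟩
  obtain ⟨y, hy, hyz⟩ := hmaps hz
  rw [Equiv.Perm.mul_apply, ← Equiv.Perm.mul_apply h, mul_inv_cancel, Equiv.Perm.one_apply] at hyz
  exact hy.2 (f.injective hyz ▸ hzP)

/-- Given a diffeomorphism rounding `C`, a larger embedded ball `C'` can be rounded without
changing the diffeomorphism on `C`. -/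
theorem exists_mem_diffGroup_extend {n : ℕ} {f H : Equiv.Perm (EuclideanSpace ℝ (Fin n))}
    {C C' : Set (EuclideanSpace ℝ (Fin n))} {ρ R : ℝ} (hf : f ∈ diffGroup univ)
    (hH : H ∈ diffGroup univ) (hρ : 0 < ρ) (hρR : ρ < R) (hC : f '' C = closedBall 0 ρ)
    (hC' : H '' closedBall 0 R = C') (hCC' : C ⊆ interior C') :
    ∃ g ∈ diffGroup univ, g '' C' = closedBall 0 R ∧ EqOn g f C := by
  have hHC : ⇑(H⁻¹) '' C' = closedBall 0 R := by
    rw [← hC', image_image]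
    simp
  have hCint := image_interior_eq_ball (inv_mem hH) (hρ.trans hρR) hHC
  have hmaps : MapsTo (H⁻¹ * f⁻¹ : Equiv.Perm _) (closedBall 0 ρ) (ball 0 R) := by
    intro x hx
    rw [← hC] at hx
    obtain ⟨y, hy, rfl⟩ := hx
    rw [← hCint]
    exact ⟨y, hCC' hy, by simp⟩
  obtain ⟨K, hK, hKeq⟩ := exists_mem_ballDiffGroup_eqOn isOpen_univ
    (isDiffeoOn_of_mem_diffGroup (mul_mem (inv_mem hH) (inv_mem hf))) hρ hρR hmaps
  refine ⟨K⁻¹ * H⁻¹, mul_mem (inv_mem hK.1) (inv_mem hH), ?_, fun x hx => ?_⟩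
  · rw [Equiv.Perm.coe_mul, image_comp, hHC]
    exact image_closedBall_of_mem_ballDiffGroup (inv_mem hK)
  · have hfx : f x ∈ closedBall 0 ρ := hC ▸ mem_image_of_mem f hx
    rw [Equiv.Perm.mul_apply, Equiv.Perm.inv_eq_iff_eq, hKeq hfx]
    simp

end Gluing

theorem isClosed_Pslab (n : ℕ) (hn : 2 ≤ n) (k : ℕ) : IsClosed (Pslab n hn k) := by
  refine isClosed_Icc.preimage (f := fun x : EuclideanSpace ℝ (Fin n) => x ⟨n - 1, by omega⟩) ?_
  fun_prop

theorem Gamma_eq_cap {n : ℕ} (hn : 2 ≤ n) {s : ℕ → ℝ} {k : ℕ} (hs : 0 < s k) (ε : ℝ) :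
    ∃ c : EuclideanSpace ℝ (Fin n), ‖c‖ = s k ∧ Gamma n hn s ε k = sphere 0 ‖c‖ \ ball c ε := by
  have hc : ‖EuclideanSpace.single (⟨n - 1, by omega⟩ : Fin n) ((-1 : ℝ) ^ k * s k)‖ = s k := by
    simp [abs_of_pos hs]
  exact ⟨_, hc, by rw [hc]; rfl⟩

/-- Lemma 2.2: existence of a diffeomorphism `Φ : Ω → 𝔹ⁿ` with
`Φ(C_k) = B_k` and `Φ(P_k ∩ C_k) ∩ Γ_k = ∅` for all `k`. -/
theorem exists_diffeo_to_ball_compatible_with_labyrinth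
    (n : ℕ) (hn : 2 ≤ n) (r s : ℕ → ℝ) (ε : ℝ)
    (hs0 : 0 < s 0) (hsr : ∀ k, s k < r k) (hrs : ∀ k, r k < s (k + 1))
    (hr1 : Tendsto r atTop (nhds 1)) (hs1 : Tendsto s atTop (nhds 1))
    (hε0 : 0 < ε) (hεs : ε < s 0)
    (Ω : Set (EuclideanSpace ℝ (Fin n))) (hΩopen : IsOpen Ω)
    (hΩdiffeo : ∃ f g, IsDiffeoOn f g Ω (ball (0 : EuclideanSpace ℝ (Fin n)) 1))
    (C : ℕ → Set (EuclideanSpace ℝ (Fin n)))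
    (hCcompact : ∀ k, IsCompact (C k)) (hCΩ : ∀ k, C k ⊆ Ω)
    -- (i) each `C k` is diffeomorphic to the closed unit ball: there is a diffeomorphism
    -- from `ℝⁿ` onto an open subset of `ℝⁿ` carrying the closed unit ball onto `C k`
    (hCball : ∀ k, ∃ (F G : EuclideanSpace ℝ (Fin n) → EuclideanSpace ℝ (Fin n))
      (U : Set (EuclideanSpace ℝ (Fin n))), IsOpen U ∧ IsDiffeoOn F G Set.univ U ∧
        F '' closedBall (0 : EuclideanSpace ℝ (Fin n)) 1 = C k)
    -- (ii)
    (hCmono : ∀ k, C k ⊆ interior (C (k + 1)))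
    -- (iii)
    (hCexh : (⋃ k, C k) = Ω)
    -- (iv)
    (hCP : ∀ k, C k ⊆ Pslab n hn (k + 1))
    -- (v)
    (hCnotP : ∀ k, (C k \ Pslab n hn k).Nonempty) :
    ∃ Φ Ψ, IsDiffeoOn Φ Ψ Ω (ball (0 : EuclideanSpace ℝ (Fin n)) 1) ∧
      ∀ k, Φ '' C k = closedBall (0 : EuclideanSpace ℝ (Fin n)) (r k) ∧
        Φ '' (Pslab n hn k ∩ C k) ∩ Gamma n hn s ε k = ∅ := by
  have hrmono : StrictMono r := strictMono_nat_of_lt_succ fun k => (hrs k).trans (hsr (k + 1))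
  have hsmono : StrictMono s := strictMono_nat_of_lt_succ fun k => (hsr k).trans (hrs k)
  have hs_pos : ∀ k, 0 < s k := fun k => hs0.trans_le (hsmono.monotone k.zero_le)
  have hr_pos : ∀ k, 0 < r k := fun k => (hs_pos k).trans (hsr k)
  have hrank : 1 < Module.rank ℝ (EuclideanSpace ℝ (Fin n)) := by
    rw [← Module.finrank_eq_rank, finrank_euclideanSpace_fin]
    exact_mod_cast hn
  have hround : ∀ k, ∃ H ∈ diffGroup univ, H '' closedBall 0 (r k) = C k := by
    intro k
    obtain ⟨F, G, U, hU, hFG, hFC⟩ := hCball k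
    rw [← hFC]
    exact exists_mem_diffGroup_image_closedBall hU hFG (hr_pos k)
  let Good : ℕ → Equiv.Perm (EuclideanSpace ℝ (Fin n)) → Prop := fun k f =>
    f ∈ diffGroup univ ∧ f '' C k = closedBall 0 (r k) ∧
      f '' (Pslab n hn k ∩ C k) ∩ Gamma n hn s ε k = ∅
  have hbase : ∃ f, Good 0 f := by
    obtain ⟨H, hH, hHC⟩ := hround 0
    have hHC' : ⇑(H⁻¹) '' C 0 = closedBall 0 (r 0) := by
      rw [← hHC, image_image]
      simp
    obtain ⟨c, hc, hΓ⟩ := Gamma_eq_cap hn (hs_pos 0) ε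
    obtain ⟨h, hh, hcap⟩ := exists_mem_diffGroup_image_inter_cap_eq_empty (inv_mem hH) (hr_pos 0)
      hHC' (isClosed_Pslab n hn 0) (hCnotP 0) hε0 isOpen_ball (convex_ball 0 (r 0)).isPreconnected
      ((image_mono sdiff_subset).trans (image_interior_eq_ball (inv_mem hH) (hr_pos 0) hHC').le)
      (c := c) (sdiff_subset.trans (sphere_subset_ball (hc.trans_lt (hsr 0))))
    refine ⟨h * H⁻¹, mul_mem (diffGroup_mono (subset_univ _) hh) (inv_mem hH), ?_, by rwa [hΓ]⟩
    rw [Equiv.Perm.coe_mul, image_comp, hHC']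
    exact image_closedBall_of_mem_ballDiffGroup (diffGroup_le_ballDiffGroup subset_rfl hh)
  have hstep : ∀ k f, Good k f → ∃ g, Good (k + 1) g ∧ EqOn g f (C k) := by
    rintro k f ⟨hf, hfC, -⟩
    obtain ⟨H, hH, hHC⟩ := hround (k + 1)
    obtain ⟨g, hg, hgC, hgf⟩ := exists_mem_diffGroup_extend hf hH (hr_pos k)
      (hrmono k.lt_succ_self) hfC hHC (hCmono k)
    obtain ⟨c, hc, hΓ⟩ := Gamma_eq_cap hn (hs_pos (k + 1)) ε
    have hopen : IsOpen {x : EuclideanSpace ℝ (Fin n) | r k < ‖x‖ ∧ ‖x‖ < r (k + 1)} :=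
      (isOpen_lt continuous_const continuous_norm).inter
        (isOpen_lt continuous_norm continuous_const)
    have hannulus : g '' (interior (C (k + 1)) \ Pslab n hn (k + 1)) ⊆
        {x | r k < ‖x‖ ∧ ‖x‖ < r (k + 1)} := by
      rintro _ ⟨x, ⟨hx1, hx2⟩, rfl⟩
      refine ⟨?_, ?_⟩
      · by_contra! hle
        rw [← mem_closedBall_zero_iff, ← hfC, ← hgf.image_eq] at hle
        obtain ⟨y, hy, hyx⟩ := hle
        exact hx2 (hCP k (g.injective hyx ▸ hy))
      · rw [← mem_ball_zero_iff, ← image_interior_eq_ball hg (hr_pos (k + 1)) hgC]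
        exact mem_image_of_mem g hx1
    have hcapU : sphere 0 ‖c‖ \ ball c ε ⊆ {x | r k < ‖x‖ ∧ ‖x‖ < r (k + 1)} := by
      rintro x ⟨hx, -⟩
      rw [mem_sphere_zero_iff_norm, hc] at hx
      exact ⟨hx ▸ hrs k, hx ▸ hsr (k + 1)⟩
    obtain ⟨h, hh, hcap⟩ := exists_mem_diffGroup_image_inter_cap_eq_empty hg (hr_pos (k + 1)) hgC
      (isClosed_Pslab n hn (k + 1)) (hCnotP (k + 1)) hε0 hopen
      (isPreconnected_annulus hrank (hr_pos k).le _) hannulus hcapU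
    refine ⟨h * g, ⟨mul_mem (diffGroup_mono (subset_univ _) hh) hg, ?_, by rwa [hΓ]⟩,
      fun x hx => ?_⟩
    · rw [Equiv.Perm.coe_mul, image_comp, hgC]
      refine image_closedBall_of_mem_ballDiffGroup (diffGroup_le_ballDiffGroup ?_ hh)
      exact fun x hx => mem_ball_zero_iff.2 hx.2
    · have hfx : f x ∈ closedBall 0 (r k) := hfC ▸ mem_image_of_mem f hx
      rw [Equiv.Perm.mul_apply, hgf hx]
      exact hh.2.2 _ fun h' => h'.1.not_ge (mem_closedBall_zero_iff.1 hfx)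
  obtain ⟨f₀, hf₀⟩ := hbase
  choose! next hnext hnext_eq using hstep
  let φ : ℕ → Equiv.Perm (EuclideanSpace ℝ (Fin n)) := fun k => Nat.rec f₀ next k
  have hφ : ∀ k, Good k (φ k) := by
    intro k
    induction k with
    | zero => exact hf₀
    | succ k ih => exact hnext k _ ih
  have hφ_eq : ∀ k, EqOn (φ (k + 1)) (φ k) (C k) := fun k => hnext_eq k _ (hφ k)
  have hφC : ∀ k, φ k '' C k = closedBall 0 (r k) := fun k => (hφ k).2.1
  have hball : ⋃ k, closedBall (0 : EuclideanSpace ℝ (Fin n)) (r k) = ball 0 1 := by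
    ext x
    rw [mem_iUnion, mem_ball_zero_iff]
    constructor
    · rintro ⟨k, hk⟩
      exact (mem_closedBall_zero_iff.1 hk).trans_lt
        ((hrmono k.lt_succ_self).trans_le (hrmono.monotone.ge_of_tendsto hr1 (k + 1)))
    · intro hx
      obtain ⟨k, hk⟩ := (hr1.eventually_const_lt hx).exists
      exact ⟨k, mem_closedBall_zero_iff.2 hk.le⟩
  obtain ⟨Φ, hΦ, hΦeq⟩ := exists_contDiffOn_iUnion_eqOn hCmono (g := fun k => φ k)
    (fun k => (hφ k).1.1) hφ_eq
  obtain ⟨Ψ, hΨ, hΨeq⟩ := exists_contDiffOn_iUnion_eqOn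
    (A := fun k => closedBall (0 : EuclideanSpace ℝ (Fin n)) (r k)) (g := fun k => (φ k).symm)
    (fun k => by
      rw [interior_closedBall _ (hr_pos (k + 1)).ne']
      exact closedBall_subset_ball (hrmono k.lt_succ_self))
    (fun k => (hφ k).1.2.1)
    (fun k y hy => by
      rw [← hφC k] at hy
      obtain ⟨x, hx, rfl⟩ := hy
      rw [← hφ_eq k hx, Equiv.symm_apply_apply, hφ_eq k hx, Equiv.symm_apply_apply])
  have hΨΦ : ∀ x ∈ ⋃ k, C k, Ψ (Φ x) = x := by
    intro x hx
    obtain ⟨k, hk⟩ := mem_iUnion.1 hx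
    rw [hΦeq k hk, hΨeq k (hφC k ▸ mem_image_of_mem _ hk), Equiv.symm_apply_apply]
  have hmaps : ∀ y ∈ ⋃ k, closedBall (0 : EuclideanSpace ℝ (Fin n)) (r k),
      Ψ y ∈ ⋃ k, C k ∧ Φ (Ψ y) = y := by
    intro y hy
    obtain ⟨k, hk⟩ := mem_iUnion.1 hy
    have hk' := hk
    rw [← hφC k] at hk'
    obtain ⟨x, hx, rfl⟩ := hk'
    rw [hΨeq k hk, Equiv.symm_apply_apply, hΦeq k hx]
    exact ⟨mem_iUnion.2 ⟨k, hx⟩, rfl⟩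
  rw [← hball, ← hCexh]
  refine ⟨Φ, Ψ, ⟨⟨fun x hx => ?_, LeftInvOn.injOn hΨΦ, fun y hy => ⟨Ψ y, hmaps y hy⟩⟩, hΦ, hΨ,
    hΨΦ, fun y hy => (hmaps y hy).2⟩, fun k => ⟨?_, ?_⟩⟩
  · obtain ⟨k, hk⟩ := mem_iUnion.1 hx
    rw [hΦeq k hk]
    exact mem_iUnion.2 ⟨k, hφC k ▸ mem_image_of_mem _ hk⟩
  · rw [(hΦeq k).image_eq, hφC k]
  · rw [((hΦeq k).mono inter_subset_right).image_eq]
    exact (hφ k).2.2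
end

section
/- Let n ≥ 2 and let Ω ⊆ ℝⁿ be an open set diffeomorphic to 𝔹ⁿ such that pr_n(Ω) is unbounded, where pr_n : ℝⁿ → ℝ is the projection to the last coordinate. Then there exists a diffeomorphism Φ from Ω onto 𝔹ⁿ with the following property: for every subset L ⊆ Ω such that pr_n(L) is bounded, every divergent smooth path γ : [0,∞) → 𝔹ⁿ whose image is contained in Φ(L) has infinite length (total variation ∞); in particular, if in addition L is closed in Ω, then Φ(L) is a closed subset of 𝔹ⁿ all of whose divergent smooth paths have infinite length. -/
open Set Metric Filter

/-- A path `γ` (with time domain `[0,∞)`) is divergent in `M` if it eventually leaves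
every compact subset of `M`. -/
def DivergentIn {E : Type*} [TopologicalSpace E] (γ : ℝ → E) (M : Set E) : Prop :=
  ∀ K : Set E, IsCompact K → K ⊆ M → ∀ᶠ t in atTop, γ t ∉ K

section Mobius

lemma add_ne_zero_of_norm_lt {E : Type*} [NormedAddCommGroup E] {a x : E} (h : ‖a‖ < ‖x‖) :
    x + a ≠ 0 := by
  intro h0
  rw [add_eq_zero_iff_eq_neg] at h0
  simp [h0] at h

variable {E : Type*} [NormedAddCommGroup E] [InnerProductSpace ℝ E]

/-- The conformal map of the sphere of radius `‖x‖` which pushes points in the direction `a`,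
where `‖a‖ < ‖x‖`. -/
noncomputable def sphereBoost (a x : E) : E :=
  ((‖x‖ ^ 2 - ‖a‖ ^ 2) / ‖x + a‖ ^ 2) • (x + a) + a

@[simp]
lemma sphereBoost_zero (x : E) : sphereBoost 0 x = x := by
  rcases eq_or_ne x 0 with rfl | hx
  · simp [sphereBoost]
  · simp [sphereBoost, hx]

lemma norm_sphereBoost {a x : E} (h : ‖a‖ < ‖x‖) : ‖sphereBoost a x‖ = ‖x‖ := by
  have hne : ‖x + a‖ ≠ 0 := by simpa using add_ne_zero_of_norm_lt h
  have hadd := norm_add_sq_real x a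
  have hin : inner ℝ (x + a) a = inner ℝ x a + ‖a‖ ^ 2 := by
    rw [inner_add_left, real_inner_self_eq_norm_sq]
  rw [← sq_eq_sq₀ (norm_nonneg _) (norm_nonneg _), sphereBoost, norm_add_sq_real, norm_smul,
    inner_smul_left, hin, mul_pow, Real.norm_eq_abs, sq_abs]
  simp only [conj_trivial]
  have : inner ℝ x a = (‖x + a‖ ^ 2 - ‖x‖ ^ 2 - ‖a‖ ^ 2) / 2 := by linarith
  rw [this]
  field_simp
  ring

lemma sphereBoost_neg_sphereBoost {a x : E} (h : ‖a‖ < ‖x‖) :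
    sphereBoost (-a) (sphereBoost a x) = x := by
  have hne : ‖x + a‖ ≠ 0 := by simpa using add_ne_zero_of_norm_lt h
  have hpos : ‖x‖ ^ 2 - ‖a‖ ^ 2 ≠ 0 := by
    have := norm_nonneg a
    nlinarith
  rw [sphereBoost, norm_sphereBoost h, norm_neg]
  have : sphereBoost a x + -a = ((‖x‖ ^ 2 - ‖a‖ ^ 2) / ‖x + a‖ ^ 2) • (x + a) := by
    simp [sphereBoost]
  rw [this, norm_smul, smul_smul, mul_pow, Real.norm_eq_abs, sq_abs]
  have : (‖x‖ ^ 2 - ‖a‖ ^ 2) / (((‖x‖ ^ 2 - ‖a‖ ^ 2) / ‖x + a‖ ^ 2) ^ 2 * ‖x + a‖ ^ 2) *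
      ((‖x‖ ^ 2 - ‖a‖ ^ 2) / ‖x + a‖ ^ 2) = 1 := by
    field_simp
  rw [this]
  simp

/-- The boost by half the difference of two points of a sphere carries one to the other. -/
lemma sphereBoost_half_sub {x y : E} (hxy : ‖x‖ = ‖y‖) (hne : x + y ≠ 0) :
    sphereBoost ((2⁻¹ : ℝ) • (y - x)) x = y := by
  have hadd : x + (2⁻¹ : ℝ) • (y - x) = (2⁻¹ : ℝ) • (x + y) := by module
  have h1 := norm_add_sq_real x y
  have h2 := norm_sub_sq_real y x
  rw [real_inner_comm] at h2
  rw [sphereBoost, hadd, norm_smul, norm_smul]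
  have : (‖x‖ ^ 2 - (‖(2⁻¹ : ℝ)‖ * ‖y - x‖) ^ 2) / (‖(2⁻¹ : ℝ)‖ * ‖x + y‖) ^ 2 = 1 := by
    rw [div_eq_one_iff_eq (by simpa using hne), mul_pow, mul_pow, h2, h1, hxy]
    norm_num
    ring
  rw [this]
  module

lemma norm_half_sub_lt {x y : E} (hxy : ‖x‖ = ‖y‖) (hne : x + y ≠ 0) :
    ‖(2⁻¹ : ℝ) • (y - x)‖ < ‖x‖ := by
  have hnz : 0 < ‖x + y‖ := by simpa using hne
  have h1 := parallelogram_law_with_norm ℝ y x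
  rw [add_comm y x, ← hxy] at h1
  rw [norm_smul]
  norm_num
  nlinarith [norm_nonneg (y - x), norm_nonneg x]

/-- A strong boost towards `v` moves everything away from `-v` close to `v`. -/
lemma exists_sphereBoost_mem_ball {v : E} (hv : v ≠ 0) {c δ : ℝ} (hc : 0 < c) (hδ : 0 < δ) :
    ∃ a : E, ‖a‖ < ‖v‖ ∧ ∀ x, ‖x‖ = ‖v‖ → c ≤ ‖x + v‖ → ‖sphereBoost a x - v‖ < δ := by
  have hR : 0 < ‖v‖ := by simpa using hv
  have hlim : Tendsto (fun τ : ℝ => τ * ‖v‖ + (2 * τ * ‖v‖ ^ 2) / (c / 2)) (nhds 0) (nhds 0) := by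
    have : Continuous (fun τ : ℝ => τ * ‖v‖ + (2 * τ * ‖v‖ ^ 2) / (c / 2)) := by fun_prop
    simpa using this.tendsto 0
  have hlim2 : Tendsto (fun τ : ℝ => τ * ‖v‖) (nhds 0) (nhds 0) := by
    have : Continuous (fun τ : ℝ => τ * ‖v‖) := by fun_prop
    simpa using this.tendsto 0
  have hev : ∀ᶠ τ : ℝ in nhdsWithin 0 (Ioi 0),
      (τ * ‖v‖ + (2 * τ * ‖v‖ ^ 2) / (c / 2) < δ ∧ τ * ‖v‖ < c / 2 ∧ τ < 1) ∧ 0 < τ := by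
    refine Filter.Eventually.and (nhdsWithin_le_nhds ?_) self_mem_nhdsWithin
    exact (hlim.eventually_lt_const hδ).and
      ((hlim2.eventually_lt_const (by positivity)).and (eventually_lt_nhds one_pos))
  obtain ⟨τ, ⟨h1, h2, h3⟩, h4⟩ := hev.exists
  refine ⟨(1 - τ) • v, ?_, fun x hx hcx => ?_⟩
  · rw [norm_smul, Real.norm_of_nonneg (by linarith)]
    nlinarith
  have hsplit : x + (1 - τ) • v = (x + v) - τ • v := by module
  have hτv : ‖τ • v‖ = τ * ‖v‖ := by rw [norm_smul, Real.norm_of_nonneg h4.le]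
  have hlow : c / 2 ≤ ‖x + (1 - τ) • v‖ := by
    rw [hsplit]
    have := norm_sub_norm_le (x + v) (τ • v)
    linarith
  have hdiff : sphereBoost ((1 - τ) • v) x - v =
      ((‖x‖ ^ 2 - ‖(1 - τ) • v‖ ^ 2) / ‖x + (1 - τ) • v‖ ^ 2) • (x + (1 - τ) • v) - τ • v := by
    rw [sphereBoost]
    module
  have hnum : ‖x‖ ^ 2 - ‖(1 - τ) • v‖ ^ 2 = τ * (2 - τ) * ‖v‖ ^ 2 := by
    rw [norm_smul, Real.norm_of_nonneg (by linarith), hx]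
    ring
  have hpos : 0 < ‖x + (1 - τ) • v‖ := by linarith
  have hnum0 : 0 ≤ τ * (2 - τ) * ‖v‖ ^ 2 :=
    mul_nonneg (mul_nonneg h4.le (by linarith)) (sq_nonneg _)
  calc ‖sphereBoost ((1 - τ) • v) x - v‖
      ≤ τ * (2 - τ) * ‖v‖ ^ 2 / ‖x + (1 - τ) • v‖ + τ * ‖v‖ := by
        rw [hdiff, hnum]
        refine (norm_sub_le _ _).trans ?_
        rw [hτv, norm_smul, Real.norm_of_nonneg (by positivity)]
        gcongr
        apply le_of_eq
        field_simp
    _ ≤ 2 * τ * ‖v‖ ^ 2 / (c / 2) + τ * ‖v‖ := by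
        gcongr ?_ / ?_ + _
        nlinarith [sq_nonneg (τ * ‖v‖)]
    _ < δ := by linarith

lemma contDiffAt_sphereBoost {F : Type*} [NormedAddCommGroup F] [NormedSpace ℝ F]
    {m : WithTop ℕ∞} {A X : F → E} {z : F}
    (hA : ContDiffAt ℝ m A z) (hX : ContDiffAt ℝ m X z) (h : X z + A z ≠ 0) :
    ContDiffAt ℝ m (fun w => sphereBoost (A w) (X w)) z := by
  unfold sphereBoost
  refine ((((hX.norm_sq ℝ).sub (hA.norm_sq ℝ)).div ((hX.add hA).norm_sq ℝ) ?_).smul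
    (hX.add hA)).add hA
  simpa using h

end Mobius

section Interpolation

open scoped Manifold ContDiff

/-- Smooth interpolation of prescribed values along a sequence tending to infinity, keeping the
norm below the square root of the argument. -/
lemma exists_contDiff_interpolation {E : Type*} [NormedAddCommGroup E] [NormedSpace ℝ E]
    {r : ℕ → ℝ} (hr : StrictMono r) (htop : Tendsto r atTop atTop) (h0 : 0 < r 0)
    {a : ℕ → E} (ha : ∀ k, ‖a k‖ < r k) :
    ∃ A : ℝ → E, ContDiff ℝ (⊤ : ℕ∞) A ∧ (∀ s < r 0 ^ 2 / 2, A s = 0) ∧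
      (∀ x : ℝ, 0 < x → ‖A (x ^ 2)‖ < x) ∧ ∀ k, A (r k ^ 2) = a k := by
  have hpos : ∀ k, 0 < r k := fun k => h0.trans_le (hr.monotone (Nat.zero_le k))
  let t : ℝ → Set E := fun s => {c | (s < r 0 ^ 2 / 2 → c = 0) ∧
    (0 < s → ‖c‖ < √s) ∧ ∀ k, s = r k ^ 2 → c = a k}
  have hconv : ∀ s, Convex ℝ (t s) := by
    intro s
    refine Convex.inter (s := {c | s < r 0 ^ 2 / 2 → c = 0}) ?_
      (Convex.inter (s := {c | 0 < s → ‖c‖ < √s}) (t := {c | ∀ k, s = r k ^ 2 → c = a k}) ?_ ?_)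
    · by_cases hs : s < r 0 ^ 2 / 2
      · simp only [hs, true_imp_iff]; exact convex_singleton 0
      · simp only [hs, false_imp_iff]; exact convex_univ
    · by_cases hs : 0 < s
      · simp only [hs, true_imp_iff]
        have : {c : E | ‖c‖ < √s} = ball 0 √s := by ext; simp
        rw [this]; exact convex_ball _ _
      · simp only [hs, false_imp_iff]; exact convex_univ
    · rw [ofPred_forall]
      refine convex_iInter fun k => ?_
      by_cases hs : s = r k ^ 2
      · simp only [hs, true_imp_iff]; exact convex_singleton (a k)
      · simp only [hs, false_imp_iff]; exact convex_univ
  have hsep : ∀ s : ℝ, ∀ᶠ y in nhds s, ∀ k, y = r k ^ 2 → y = s := by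
    intro s
    obtain ⟨N, hN⟩ := ((htop.eventually_ge_atTop (s + 1)).and
      (htop.eventually_ge_atTop 1)).exists_forall_of_atTop
    have hfin : ((fun k => r k ^ 2) '' Iio N \ {s}).Finite := ((finite_Iio N).image _).sdiff
    filter_upwards [hfin.isClosed.isOpen_compl.mem_nhds (by simp : s ∈ _),
      eventually_lt_nhds (lt_add_one s)] with y hy hlt k hk
    by_contra hne
    rcases lt_or_ge k N with hkN | hkN
    · exact hy ⟨⟨k, hkN, hk.symm⟩, hne⟩
    · obtain ⟨h1, h2⟩ := hN k hkN
      nlinarith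
  have hloc : ∀ s : ℝ, ∃ c : E, ∀ᶠ y in nhds s, c ∈ t y := by
    intro s
    by_cases hs : ∃ k, s = r k ^ 2
    · obtain ⟨k, rfl⟩ := hs
      refine ⟨a k, ?_⟩
      have hk0 : r 0 ^ 2 / 2 < r k ^ 2 := by
        have := hr.monotone (Nat.zero_le k)
        nlinarith
      have hlt : ‖a k‖ < √(r k ^ 2) := by rw [Real.sqrt_sq (hpos k).le]; exact ha k
      filter_upwards [hsep (r k ^ 2), eventually_gt_nhds hk0,
        Real.continuous_sqrt.continuousAt.eventually_const_lt hlt] with y h1 h2 h3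
      refine ⟨fun h => absurd h h2.not_gt, fun _ => h3, fun j hj => ?_⟩
      have : r j ^ 2 = r k ^ 2 := hj.symm.trans (h1 j hj)
      rw [sq_eq_sq₀ (hpos j).le (hpos k).le] at this
      rw [hr.injective this]
    · refine ⟨0, ?_⟩
      filter_upwards [hsep s] with y hy
      refine ⟨fun _ => rfl, fun h => by simpa using h, fun k hk => ?_⟩
      exact absurd ⟨k, (hy k hk).symm.trans hk⟩ hs
  obtain ⟨A, hA⟩ := exists_contMDiffMap_forall_mem_convex_of_local_const (n := (⊤ : ℕ∞))
    𝓘(ℝ, ℝ) hconv hloc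
  refine ⟨A, A.contMDiff.contDiff, fun s => (hA s).1, fun x hx => ?_, fun k => (hA _).2.2 k rfl⟩
  have := (hA (x ^ 2)).2.1 (by positivity)
  rwa [Real.sqrt_sq hx.le] at this

/-- A norm-preserving diffeomorphism which restricts to prescribed boosts on a sequence of spheres
of radii tending to infinity. -/
lemma exists_diffeo_eq_sphereBoost {E : Type*} [NormedAddCommGroup E] [InnerProductSpace ℝ E]
    {r : ℕ → ℝ} (hr : StrictMono r) (htop : Tendsto r atTop atTop) (h0 : 0 < r 0)
    {a : ℕ → E} (ha : ∀ k, ‖a k‖ < r k) :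
    ∃ ψ χ : E → E, ContDiff ℝ (⊤ : ℕ∞) ψ ∧ ContDiff ℝ (⊤ : ℕ∞) χ ∧
      Function.LeftInverse χ ψ ∧ Function.RightInverse χ ψ ∧
      (∀ x, ‖ψ x‖ = ‖x‖) ∧ ∀ k x, ‖x‖ = r k → ψ x = sphereBoost (a k) x := by
  obtain ⟨A, hA, hzero, hlt, hval⟩ := exists_contDiff_interpolation hr htop h0 ha
  have hA0 : A 0 = 0 := hzero 0 (by positivity)
  have hsmooth : ∀ B : ℝ → E, ContDiff ℝ (⊤ : ℕ∞) B → (∀ s < r 0 ^ 2 / 2, B s = 0) →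
      (∀ x : ℝ, 0 < x → ‖B (x ^ 2)‖ < x) →
      ContDiff ℝ (⊤ : ℕ∞) (fun x : E => sphereBoost (B (‖x‖ ^ 2)) x) := by
    intro B hB hBzero hBlt
    rw [contDiff_iff_contDiffAt]
    intro x
    rcases eq_or_ne x 0 with rfl | hx
    · refine contDiffAt_id.congr_of_eventuallyEq ?_
      have hc : ContinuousAt (fun x : E => ‖x‖ ^ 2) 0 := by fun_prop
      filter_upwards [hc.eventually_lt_const (by simp; positivity : ‖(0 : E)‖ ^ 2 < r 0 ^ 2 / 2)]
        with y hy
      simp [hBzero _ hy]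
    · exact contDiffAt_sphereBoost (hB.comp (contDiff_norm_sq ℝ)).contDiffAt contDiffAt_id
        (add_ne_zero_of_norm_lt (hBlt _ (norm_pos_iff.2 hx)))
  have hnorm : ∀ B : ℝ → E, B 0 = 0 → (∀ x : ℝ, 0 < x → ‖B (x ^ 2)‖ < x) →
      ∀ x : E, ‖sphereBoost (B (‖x‖ ^ 2)) x‖ = ‖x‖ ∧
        sphereBoost (-B (‖x‖ ^ 2)) (sphereBoost (B (‖x‖ ^ 2)) x) = x := by
    intro B hB0 hBlt x
    rcases eq_or_ne x 0 with rfl | hx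
    · simp [hB0]
    · have := hBlt _ (norm_pos_iff.2 hx)
      exact ⟨norm_sphereBoost this, sphereBoost_neg_sphereBoost this⟩
  have h1 := hnorm A hA0 hlt
  have h2 := hnorm (-A) (by simp [hA0]) (by simpa using hlt)
  refine ⟨fun x => sphereBoost (A (‖x‖ ^ 2)) x, fun x => sphereBoost (-A (‖x‖ ^ 2)) x,
    hsmooth A hA hzero hlt,
    hsmooth (-A) hA.neg (fun s hs => by simp [hzero s hs]) (by simpa using hlt),
    fun x => ?_, fun x => ?_, fun x => (h1 x).1, fun k x hx => ?_⟩
  · simp only [(h1 x).1, (h1 x).2]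
  · have := h2 x
    simp only [Pi.neg_apply, neg_neg] at this
    simp only [this.1, this.2]
  · simp only [hx, hval]

end Interpolation

/-- Alternating choice of unit vectors avoiding the directions opposite to a given sequence. -/
lemma exists_alternating_unit_vectors {E : Type*} [NormedAddCommGroup E] [InnerProductSpace ℝ E]
    {e e' : E} (he : ‖e‖ = 1) (he' : ‖e'‖ = 1) (hee' : inner ℝ e e' = 0)
    (x : ℕ → E) (hx : ∀ k, x k ≠ 0) :
    ∃ v : ℕ → E, (∀ k, ‖v k‖ = 1) ∧ (∀ k, 1 ≤ ‖v (2 * k) - v (2 * k + 1)‖) ∧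
      ∀ k, ‖x k‖ • v k + x k ≠ 0 := by
  have hne : ∀ s : ℝ, s ≠ 0 → ∀ y : E, y ≠ 0 →
      ∃ w ∈ ({e, e'} : Set E), ‖y‖ • s • w + y ≠ 0 := by
    intro s hs y hy
    by_contra! hcon
    have h1 := hcon e (by simp)
    have h2 := hcon e' (by simp)
    have h3 : e = e' := by
      have : ‖y‖ • s • e = ‖y‖ • s • e' := add_right_cancel (h1.trans h2.symm)
      exact smul_right_injective E hs (smul_right_injective E (norm_ne_zero_iff.2 hy) this)
    rw [← h3, real_inner_self_eq_norm_sq, he] at hee'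
    norm_num at hee'
  choose w hw hw' using fun k => hne ((-1) ^ k) (pow_ne_zero _ (by norm_num)) (x k) (hx k)
  refine ⟨fun k => (-1 : ℝ) ^ k • w k, fun k => ?_, fun k => ?_, hw'⟩
  · have : ‖w k‖ = 1 := by rcases hw k with h | h <;> rw [h] <;> assumption
    simp [norm_smul, this]
  · have hkey : ∀ a ∈ ({e, e'} : Set E), inner ℝ a (e + e') = 1 := by
      rintro a (rfl | rfl)
      · rw [inner_add_right, hee', real_inner_self_eq_norm_sq, he]; norm_num
      · rw [inner_add_right, real_inner_comm, hee', real_inner_self_eq_norm_sq, he']; norm_num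
    have h2 : inner ℝ (w (2 * k) + w (2 * k + 1)) (e + e') = 2 := by
      rw [inner_add_left, hkey _ (hw _), hkey _ (hw _)]; norm_num
    have h3 : ‖e + e'‖ ≤ 2 := (norm_add_le _ _).trans (by rw [he, he']; norm_num)
    have h4 := real_inner_le_norm (w (2 * k) + w (2 * k + 1)) (e + e')
    have h5 : (-1 : ℝ) ^ (2 * k) • w (2 * k) - (-1 : ℝ) ^ (2 * k + 1) • w (2 * k + 1) =
        w (2 * k) + w (2 * k + 1) := by
      simp [pow_succ, pow_mul]
    rw [h5]
    nlinarith [norm_nonneg (w (2 * k) + w (2 * k + 1))]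

/-- An unbounded continuous function can be made large, by a change of variables, on a sequence of
spheres from which small caps around alternating directions have been removed. -/
lemma exists_diffeo_large_on_punctured_spheres {E : Type*} [NormedAddCommGroup E]
    [InnerProductSpace ℝ E] [ProperSpace E] {e e' : E} (he : ‖e‖ = 1) (he' : ‖e'‖ = 1)
    (hee' : inner ℝ e e' = 0) {h : E → ℝ} (hc : Continuous h) (hunb : ∀ C, ∃ x, C < |h x|) :
    ∃ (ψ χ : E → E) (r : ℕ → ℝ) (v : ℕ → E), ContDiff ℝ (⊤ : ℕ∞) ψ ∧ ContDiff ℝ (⊤ : ℕ∞) χ ∧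
      Function.LeftInverse χ ψ ∧ Function.RightInverse χ ψ ∧
      Tendsto r atTop atTop ∧ (∀ k, 0 < r k) ∧
      (∀ k, 1 ≤ ‖v (2 * k) - v (2 * k + 1)‖) ∧
      ∀ k x, ‖x‖ = r k → r k / 4 ≤ ‖x + r k • v k‖ → (k : ℝ) < |h (ψ x)| := by
  have hex : ∀ k : ℕ, ∃ x : E, (k : ℝ) < ‖x‖ ∧ (k : ℝ) < |h x| := by
    intro k
    obtain ⟨C, hC⟩ := (isCompact_closedBall (0 : E) k).exists_bound_of_continuousOn hc.continuousOn
    obtain ⟨x, hx⟩ := hunb (max C k)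
    refine ⟨x, ?_, (le_max_right _ _).trans_lt hx⟩
    by_contra! hle
    exact absurd (hC x (by simpa using hle)) (not_le.2 ((le_max_left _ _).trans_lt hx))
  choose y hy hhy using hex
  obtain ⟨φ, hφ, hmono⟩ := strictMono_subseq_of_tendsto_atTop
    (tendsto_atTop_mono (fun k => (hy k).le) tendsto_natCast_atTop_atTop)
  let x : ℕ → E := y ∘ φ
  have hkφ : ∀ k : ℕ, (k : ℝ) ≤ φ k := fun k => by exact_mod_cast hφ.le_apply
  have hkx : ∀ k : ℕ, (k : ℝ) < ‖x k‖ := fun k => (hkφ k).trans_lt (hy _)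
  have hhx : ∀ k : ℕ, (k : ℝ) < |h (x k)| := fun k => (hkφ k).trans_lt (hhy _)
  have hpos : ∀ k, 0 < ‖x k‖ := fun k => (Nat.cast_nonneg k).trans_lt (hkx k)
  have htop : Tendsto (fun k => ‖x k‖) atTop atTop :=
    tendsto_atTop_mono (fun k => (hkx k).le) tendsto_natCast_atTop_atTop
  obtain ⟨v, hv, halt, hvx⟩ := exists_alternating_unit_vectors he he' hee' x
    fun k => norm_pos_iff.1 (hpos k)
  have hnv : ∀ k, ‖‖x k‖ • v k‖ = ‖x k‖ := fun k => by simp [norm_smul, hv]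
  obtain ⟨ψ₁, χ₁, hψ₁, hχ₁, hl₁, hr₁, -, hb₁⟩ := exists_diffeo_eq_sphereBoost hmono htop (hpos 0)
    (a := fun k => (2⁻¹ : ℝ) • (x k - ‖x k‖ • v k))
    fun k => (norm_half_sub_lt (hnv k) (hvx k)).trans_eq (hnv k)
  have hlarge : ∀ k : ℕ, (k : ℝ) < |h (ψ₁ (‖x k‖ • v k))| := by
    intro k
    rw [hb₁ k _ (hnv k), sphereBoost_half_sub (hnv k) (hvx k)]
    exact hhx k
  have hδ : ∀ k : ℕ, ∃ δ > 0, ∀ z, ‖z - ‖x k‖ • v k‖ < δ → (k : ℝ) < |h (ψ₁ z)| := by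
    intro k
    have hcont : Continuous fun z => |h (ψ₁ z)| := (hc.comp hψ₁.continuous).abs
    obtain ⟨δ, hδ, hsub⟩ := Metric.eventually_nhds_iff.1
      (hcont.continuousAt.eventually_const_lt (hlarge k))
    exact ⟨δ, hδ, fun z hz => hsub (by rwa [dist_eq_norm])⟩
  choose δ hδ hδ' using hδ
  have ha : ∀ k, ∃ a : E, ‖a‖ < ‖x k‖ ∧ ∀ z, ‖z‖ = ‖x k‖ → ‖x k‖ / 4 ≤ ‖z + ‖x k‖ • v k‖ →
      ‖sphereBoost a z - ‖x k‖ • v k‖ < δ k := by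
    intro k
    have := exists_sphereBoost_mem_ball (v := ‖x k‖ • v k)
      (norm_pos_iff.1 ((hnv k).symm ▸ hpos k)) (c := ‖x k‖ / 4) (by linarith [hpos k]) (hδ k)
    rwa [hnv k] at this
  choose a ha ha' using ha
  obtain ⟨ψ₂, χ₂, hψ₂, hχ₂, hl₂, hr₂, -, hb₂⟩ := exists_diffeo_eq_sphereBoost hmono htop (hpos 0) ha
  refine ⟨ψ₁ ∘ ψ₂, χ₂ ∘ χ₁, fun k => ‖x k‖, v, hψ₁.comp hψ₂, hχ₂.comp hχ₁, hl₁.comp hl₂,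
    hr₁.comp hr₂, htop, hpos, halt, fun k z hz hz' => hδ' k _ ?_⟩
  rw [hb₂ k z hz]
  exact ha' k z hz hz'

/-- A divergent path in the unit ball which crosses each large sphere of a sequence (after the
identification of the ball with the whole space) only in small caps around alternating directions
has infinite length. -/
lemma eVariationOn_eq_top_of_forall_mem_caps {E : Type*} [NormedAddCommGroup E]
    [InnerProductSpace ℝ E] [ProperSpace E] {r : ℕ → ℝ} {v : ℕ → E}
    (htop : Tendsto r atTop atTop) (hpos : ∀ k, 0 < r k)
    (halt : ∀ k, 1 ≤ ‖v (2 * k) - v (2 * k + 1)‖)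
    {γ : ℝ → E} (hγ : ContinuousOn γ (Ici 0)) (hmem : ∀ t ∈ Ici (0 : ℝ), γ t ∈ ball (0 : E) 1)
    (hdiv : DivergentIn γ (ball (0 : E) 1))
    (hcaps : ∀ᶠ k in atTop, ∀ t ∈ Ici (0 : ℝ),
      ‖OpenPartialHomeomorph.univUnitBall.symm (γ t)‖ = r k →
      ‖OpenPartialHomeomorph.univUnitBall.symm (γ t) + r k • v k‖ < r k / 4) :
    eVariationOn γ (Ici 0) = ⊤ := by
  by_contra hfin
  obtain ⟨p, hp⟩ := BoundedVariationOn.exists_tendsto_left_of_filter (s := Ici (0 : ℝ)) hfin atTop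
    (fun y hy => inter_mem (Ici_mem_atTop 0) (Ici_mem_atTop y)) ⟨0, self_mem_Ici⟩
  let σ : ℝ → E := fun t => OpenPartialHomeomorph.univUnitBall.symm (γ t)
  have hσc : ContinuousOn σ (Ici 0) :=
    (OpenPartialHomeomorph.contDiffOn_univUnitBall_symm (n := 0)).continuousOn.comp hγ hmem
  have hσeq : ∀ t ∈ Ici (0 : ℝ), OpenPartialHomeomorph.univUnitBall (σ t) = γ t := fun t ht =>
    OpenPartialHomeomorph.univUnitBall.right_inv (hmem t ht)
  have hσtop : ∀ M : ℝ, ∀ᶠ t in atTop, M < ‖σ t‖ := by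
    intro M
    have hK : IsCompact (OpenPartialHomeomorph.univUnitBall '' closedBall (0 : E) M) :=
      (isCompact_closedBall 0 M).image
        (OpenPartialHomeomorph.contDiff_univUnitBall (n := 0)).continuous
    have hKsub : OpenPartialHomeomorph.univUnitBall '' closedBall (0 : E) M ⊆ ball 0 1 := by
      rintro _ ⟨z, -, rfl⟩
      exact OpenPartialHomeomorph.univUnitBall.map_source (mem_univ z)
    filter_upwards [hdiv _ hK hKsub, eventually_ge_atTop 0] with t ht ht0
    by_contra! hle
    exact ht ⟨σ t, by simpa using hle, hσeq t ht0⟩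
  have hpnorm : ‖p‖ = 1 := by
    refine le_antisymm (le_of_tendsto hp.norm ?_) (le_of_forall_lt fun c hc => ?_)
    · filter_upwards [eventually_ge_atTop 0] with t ht
      exact (mem_ball_zero_iff.1 (hmem t ht)).le
    · obtain ⟨c', hcc', hc'⟩ := exists_between hc
      refine hcc'.trans_le (ge_of_tendsto hp.norm ?_)
      filter_upwards [hdiv _ (isCompact_closedBall 0 c') (closedBall_subset_ball hc')] with t ht
      simpa using (not_le.1 fun hle => ht (mem_closedBall_zero_iff.2 hle)).le
  have hdir : Tendsto (fun t => ‖γ t‖⁻¹ • γ t) atTop (nhds p) := by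
    simpa [hpnorm] using (hp.norm.inv₀ (by simp [hpnorm])).smul hp
  have hσdir : ∀ t, ‖σ t‖⁻¹ • σ t = ‖γ t‖⁻¹ • γ t ∨ γ t ∉ ball (0 : E) 1 := by
    intro t
    by_cases ht : γ t ∈ ball (0 : E) 1
    · left
      have hs : 0 < √(1 - ‖γ t‖ ^ 2) := by
        have := mem_ball_zero_iff.1 ht
        exact Real.sqrt_pos.2 (by nlinarith [norm_nonneg (γ t)])
      simp only [σ, OpenPartialHomeomorph.univUnitBall_symm_apply, norm_smul, norm_inv,
        Real.norm_of_nonneg hs.le, smul_smul]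
      congr 1
      field_simp
    · exact Or.inr ht
  obtain ⟨T, hT⟩ := ((Metric.tendsto_nhds.1 hdir (1 / 4) (by norm_num)).and
    (eventually_ge_atTop 0)).exists_forall_of_atTop
  have hT0 : 0 ≤ T := (hT T le_rfl).2
  have hnear : ∀ᶠ k in atTop, ‖p + v k‖ < 1 / 2 := by
    filter_upwards [hcaps, htop.eventually_ge_atTop ‖σ T‖] with k hk hrk
    obtain ⟨S, hS⟩ := ((hσtop (r k)).and (eventually_ge_atTop T)).exists
    obtain ⟨t, ht, hσt⟩ := intermediate_value_Icc hS.2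
      (hσc.norm.mono (Icc_subset_Ici_self.trans (Ici_subset_Ici.2 hT0))) ⟨hrk, hS.1.le⟩
    have ht0 : t ∈ Ici (0 : ℝ) := hT0.trans ht.1
    have hcap := hk t ht0 hσt
    have hd := (hT t ht.1).1
    rw [← (hσdir t).resolve_right (not_not.2 (hmem t ht0)), dist_eq_norm] at hd
    have hσt' : ‖σ t‖ = r k := hσt
    rw [hσt'] at hd
    have hscale : ‖(r k)⁻¹ • σ t + v k‖ < 1 / 4 := by
      have : (r k)⁻¹ • σ t + v k = (r k)⁻¹ • (σ t + r k • v k) := by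
        rw [smul_add, smul_smul, inv_mul_cancel₀ (hpos k).ne', one_smul]
      rw [this, norm_smul, norm_inv, Real.norm_of_nonneg (hpos k).le, inv_mul_lt_iff₀ (hpos k)]
      exact hcap.trans_eq (by ring)
    calc ‖p + v k‖ = ‖((r k)⁻¹ • σ t + v k) - ((r k)⁻¹ • σ t - p)‖ := by congr 1; abel
      _ ≤ ‖(r k)⁻¹ • σ t + v k‖ + ‖(r k)⁻¹ • σ t - p‖ := norm_sub_le _ _
      _ < 1 / 2 := by linarith
  obtain ⟨N, hN⟩ := hnear.exists_forall_of_atTop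
  have h1 := hN (2 * N) (by omega)
  have h2 := hN (2 * N + 1) (by omega)
  have h3 : v (2 * N) - v (2 * N + 1) = (p + v (2 * N)) - (p + v (2 * N + 1)) := by abel
  have h4 := halt N
  rw [h3] at h4
  linarith [norm_sub_le (p + v (2 * N)) (p + v (2 * N + 1))]

/-- Proposition 2.5, leafwise: if `Ω ⊆ ℝⁿ` is open, diffeomorphic to `𝔹ⁿ`,
and vertically unbounded, then there is a diffeomorphism `Φ : Ω → 𝔹ⁿ` such that for every
vertically bounded `L ⊆ Ω`, every divergent smooth path in `𝔹ⁿ` with image in `Φ(L)` has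
infinite length; moreover if `L` is closed in `Ω` then `Φ(L)` is closed in `𝔹ⁿ`. -/
theorem exists_diffeo_to_ball_making_slab_bounded_sets_complete
    (n : ℕ) (hn : 2 ≤ n)
    (Ω : Set (EuclideanSpace ℝ (Fin n))) (hΩopen : IsOpen Ω)
    (hΩdiffeo : ∃ f g, IsDiffeoOn f g Ω (ball (0 : EuclideanSpace ℝ (Fin n)) 1))
    (hΩunbdd : ¬ Bornology.IsBounded
      ((fun x : EuclideanSpace ℝ (Fin n) => x (⟨n - 1, by omega⟩ : Fin n)) '' Ω)) :
    ∃ Φ Ψ, IsDiffeoOn Φ Ψ Ω (ball (0 : EuclideanSpace ℝ (Fin n)) 1) ∧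
      ∀ L : Set (EuclideanSpace ℝ (Fin n)), L ⊆ Ω →
        Bornology.IsBounded
          ((fun x : EuclideanSpace ℝ (Fin n) => x (⟨n - 1, by omega⟩ : Fin n)) '' L) →
        (∀ γ : ℝ → EuclideanSpace ℝ (Fin n),
          ContDiffOn ℝ (⊤ : ℕ∞) γ (Ici (0 : ℝ)) →
          DivergentIn γ (ball (0 : EuclideanSpace ℝ (Fin n)) 1) →
          (∀ t ∈ Ici (0 : ℝ), γ t ∈ Φ '' L) →
          eVariationOn γ (Ici 0) = ⊤) ∧
        (closure L ∩ Ω ⊆ L →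
          closure (Φ '' L) ∩ ball (0 : EuclideanSpace ℝ (Fin n)) 1 ⊆ Φ '' L) := by
  obtain ⟨f, g, ⟨hbij, hf, hg, hgf, hfg⟩⟩ := hΩdiffeo
  let last : Fin n := ⟨n - 1, by omega⟩
  let B : OpenPartialHomeomorph (EuclideanSpace ℝ (Fin n)) (EuclideanSpace ℝ (Fin n)) :=
    OpenPartialHomeomorph.univUnitBall
  have hB : ContDiff ℝ (⊤ : ℕ∞) B := OpenPartialHomeomorph.contDiff_univUnitBall
  have hBs : ContDiffOn ℝ (⊤ : ℕ∞) B.symm (ball 0 1) :=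
    OpenPartialHomeomorph.contDiffOn_univUnitBall_symm
  have hBmem : ∀ x, B x ∈ ball (0 : EuclideanSpace ℝ (Fin n)) 1 := fun x =>
    B.map_source (mem_univ x)
  have hBl : ∀ x, B.symm (B x) = x := fun x => B.left_inv (mem_univ x)
  have hBr : ∀ y ∈ ball (0 : EuclideanSpace ℝ (Fin n)) 1, B (B.symm y) = y := fun y hy =>
    B.right_inv hy
  have hgmem : ∀ y ∈ ball (0 : EuclideanSpace ℝ (Fin n)) 1, g y ∈ Ω := by
    intro y hy
    obtain ⟨x, hx, rfl⟩ := hbij.surjOn hy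
    have : g (f x) = x := hgf hx
    rwa [this]
  have hgf' : ∀ x ∈ Ω, g (f x) = x := fun x hx => hgf hx
  have hfg' : ∀ y ∈ ball (0 : EuclideanSpace ℝ (Fin n)) 1, f (g y) = y := fun y hy => hfg hy
  have hgB : ContDiff ℝ (⊤ : ℕ∞) (g ∘ B) := hg.comp_contDiff hB hBmem
  have hcoord : Continuous fun x : EuclideanSpace ℝ (Fin n) => x last := by fun_prop
  obtain ⟨ψ, χ, r, v, hψ, hχ, hl, hr, htop, hpos, halt, hwall⟩ :=
    exists_diffeo_large_on_punctured_spheres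
      (e := EuclideanSpace.single (⟨0, by omega⟩ : Fin n) (1 : ℝ))
      (e' := EuclideanSpace.single (⟨1, by omega⟩ : Fin n) (1 : ℝ))
      (by simp) (by simp) (by simp [EuclideanSpace.inner_single_left])
      (h := fun x => g (B x) last) (hcoord.comp hgB.continuous) (by
        intro C
        by_contra! hle
        refine hΩunbdd (isBounded_iff_forall_norm_le.2 ⟨C, ?_⟩)
        rintro _ ⟨x, hx, rfl⟩
        have := hle (B.symm (f x))
        rwa [hBr _ (hbij.mapsTo hx), hgf' x hx] at this)
  have hinv : ∀ x ∈ Ω, g (B (ψ (B.symm (B (χ (B.symm (f x))))))) = x := by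
    intro x hx
    rw [hBl, hr, hBr _ (hbij.mapsTo hx), hgf' x hx]
  have hinv' : ∀ y ∈ ball (0 : EuclideanSpace ℝ (Fin n)) 1,
      B (χ (B.symm (f (g (B (ψ (B.symm y))))))) = y := by
    intro y hy
    rw [hfg' _ (hBmem _), hBl, hl, hBr y hy]
  have hΨ : ContDiffOn ℝ (⊤ : ℕ∞) (fun y => g (B (ψ (B.symm y)))) (ball 0 1) :=
    (hgB.comp hψ).comp_contDiffOn hBs
  refine ⟨fun x => B (χ (B.symm (f x))), fun y => g (B (ψ (B.symm y))),
    ⟨⟨fun x _ => hBmem _, fun x hx y hy hxy => ?_, fun y hy => ⟨_, hgmem _ (hBmem _), hinv' y hy⟩⟩,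
      (hB.comp hχ).comp_contDiffOn (hBs.comp hf hbij.mapsTo), hΨ, hinv, hinv'⟩, ?_⟩
  · rw [← hinv x hx, ← hinv y hy]
    exact congrArg (fun z => g (B (ψ (B.symm z)))) hxy
  intro L hL hLbdd
  refine ⟨fun γ hγ hdiv hγL => ?_, fun hcl y hy => ?_⟩
  · obtain ⟨C, hC⟩ := isBounded_iff_forall_norm_le.1 hLbdd
    have hmem : ∀ t ∈ Ici (0 : ℝ), γ t ∈ ball (0 : EuclideanSpace ℝ (Fin n)) 1 := by
      intro t ht
      obtain ⟨x, -, hx⟩ := hγL t ht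
      rw [← hx]
      exact hBmem _
    refine eVariationOn_eq_top_of_forall_mem_caps htop hpos halt hγ.continuousOn hmem hdiv ?_
    filter_upwards [tendsto_natCast_atTop_atTop.eventually_ge_atTop C] with k hk t ht hnorm
    by_contra! hge
    have hlt := hwall k _ hnorm hge
    obtain ⟨x, hxL, hx⟩ := hγL t ht
    have hxt : g (B (ψ (B.symm (γ t)))) = x := by rw [← hx]; exact hinv x (hL hxL)
    have hle := hC _ (mem_image_of_mem _ hxL)
    rw [← hxt] at hle
    exact absurd (hlt.trans_le hle) hk.not_gt
  · have hcont : ContinuousAt (fun y => g (B (ψ (B.symm y)))) y :=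
      hΨ.continuousOn.continuousAt (isOpen_ball.mem_nhds hy.2)
    have hcl' : g (B (ψ (B.symm y))) ∈ closure L := by
      refine closure_mono ?_ (hcont.continuousWithinAt.mem_closure_image hy.1)
      rintro _ ⟨_, ⟨x, hx, rfl⟩, rfl⟩
      simpa only [hinv x (hL hx)] using hx
    exact ⟨_, hcl ⟨hcl', hgmem _ (hBmem _)⟩, hinv' y hy.2⟩
end

section
/- Let X⁺ and X⁻ be disjoint closed subsets of ℝ². Then the set Ω = ℝ³ ∖ ((X⁺ × [−1,∞)) ∪ (X⁻ × (−∞,1])) is an open subset of ℝ³ which is diffeomorphic to ℝ³. -/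
open Set Real

/-- If `s² = v² + 4 a b`, then `t = (s + v + 2 b) / (s - v + 2 a)` solves `a t - b / t = v`. -/
lemma mul_div_sub_div_eq_of_sq_eq {a b v s : ℝ} (hs : s ^ 2 = v ^ 2 + 4 * (a * b))
    (hn : s + v + 2 * b ≠ 0) (hd : s - v + 2 * a ≠ 0) :
    a * ((s + v + 2 * b) / (s - v + 2 * a)) - b / ((s + v + 2 * b) / (s - v + 2 * a)) = v := by
  have h : a * (s + v + 2 * b) ^ 2 - b * (s - v + 2 * a) ^ 2
      = v * (s + v + 2 * b) * (s - v + 2 * a) := by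
    linear_combination (a - b - v) * hs
  rw [mul_div_assoc', div_div_eq_mul_div, div_sub_div _ _ hd hn, div_eq_iff (mul_ne_zero hd hn)]
  linear_combination h

/-- The root formula applied to `v = a t - b / t` recovers `t`. -/
lemma div_eq_of_sqrt_discrim {a b t : ℝ} (ha : 0 ≤ a) (hb : 0 ≤ b) (hab : 0 < a + b)
    (ht : 0 < t) :
    (√((a * t - b / t) ^ 2 + 4 * (a * b)) + (a * t - b / t) + 2 * b) /
      (√((a * t - b / t) ^ 2 + 4 * (a * b)) - (a * t - b / t) + 2 * a) = t := by
  have hs : √((a * t - b / t) ^ 2 + 4 * (a * b)) = a * t + b / t := by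
    rw [show (a * t - b / t) ^ 2 + 4 * (a * b) = (a * t + b / t) ^ 2 by field_simp; ring]
    exact sqrt_sq (by positivity)
  rw [hs, show a * t + b / t + (a * t - b / t) + 2 * b = 2 * (a * t + b) by ring,
    show a * t + b / t - (a * t - b / t) + 2 * a = 2 * (a * t + b) / t by field_simp; ring]
  have : 0 < a * t + b := by
    rcases ha.eq_or_lt with rfl | ha
    · simpa using hab
    · positivity
  field_simp

/-- For nonnegative `a`, `b`, if `v < 0` when `a = 0` and `0 < v` when `b = 0`, then the
discriminant of `a t² - v t - b` and both terms of its positive root are positive. -/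
lemma discrim_pos_and_root_terms_pos {a b v : ℝ} (ha : 0 ≤ a) (hb : 0 ≤ b)
    (hav : a = 0 → v < 0) (hbv : b = 0 → 0 < v) :
    0 < v ^ 2 + 4 * (a * b) ∧ 0 < √(v ^ 2 + 4 * (a * b)) + v + 2 * b ∧
      0 < √(v ^ 2 + 4 * (a * b)) - v + 2 * a := by
  have habs : |v| ≤ √(v ^ 2 + 4 * (a * b)) := abs_le_sqrt (by nlinarith [mul_nonneg ha hb])
  have h₁ := neg_abs_le v
  have h₂ := le_abs_self v
  rcases ha.eq_or_lt with rfl | ha'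
  · have hv := hav rfl
    have hb' : 0 < b := hb.lt_of_ne fun h => (hbv h.symm).not_gt hv
    exact ⟨by nlinarith, by linarith, by linarith⟩
  · rcases hb.eq_or_lt with rfl | hb'
    · have hv := hbv rfl
      exact ⟨by nlinarith, by linarith, by linarith⟩
    · exact ⟨by positivity, by linarith, by linarith⟩

/-- for disjoint closed sets `X⁺, X⁻ ⊆ ℝ²`, the set
`Ω = ℝ³ ∖ ((X⁺ × [−1,∞)) ∪ (X⁻ × (−∞,1]))` is open and diffeomorphic to `ℝ³`. -/
theorem complement_of_halfLines_over_disjoint_closed_sets_diffeo_R3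
    (Xp Xm : Set (ℝ × ℝ)) (hXp : IsClosed Xp) (hXm : IsClosed Xm)
    (hdisj : Disjoint Xp Xm) :
    IsOpen (({q : ℝ × ℝ × ℝ | (q.1, q.2.1) ∈ Xp ∧ -1 ≤ q.2.2} ∪
        {q : ℝ × ℝ × ℝ | (q.1, q.2.1) ∈ Xm ∧ q.2.2 ≤ 1})ᶜ) ∧
      ∃ f g : ℝ × ℝ × ℝ → ℝ × ℝ × ℝ,
        Set.BijOn f (({q : ℝ × ℝ × ℝ | (q.1, q.2.1) ∈ Xp ∧ -1 ≤ q.2.2} ∪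
          {q : ℝ × ℝ × ℝ | (q.1, q.2.1) ∈ Xm ∧ q.2.2 ≤ 1})ᶜ) Set.univ ∧
        ContDiffOn ℝ (⊤ : ℕ∞) f (({q : ℝ × ℝ × ℝ | (q.1, q.2.1) ∈ Xp ∧ -1 ≤ q.2.2} ∪
          {q : ℝ × ℝ × ℝ | (q.1, q.2.1) ∈ Xm ∧ q.2.2 ≤ 1})ᶜ) ∧
        ContDiff ℝ (⊤ : ℕ∞) g ∧
        Set.EqOn (g ∘ f) id (({q : ℝ × ℝ × ℝ | (q.1, q.2.1) ∈ Xp ∧ -1 ≤ q.2.2} ∪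
          {q : ℝ × ℝ × ℝ | (q.1, q.2.1) ∈ Xm ∧ q.2.2 ≤ 1})ᶜ) ∧
        (∀ x : ℝ × ℝ × ℝ, f (g x) = x) := by
  obtain ⟨φ, hφ, hrange, hp, hm⟩ := exists_contMDiff_zero_iff_one_iff_of_isClosed
    (modelWithCornersSelf ℝ (ℝ × ℝ)) (n := (⊤ : ℕ∞)) hXp hXm hdisj
  rw [contMDiff_iff_contDiff] at hφ
  have h0 (p : ℝ × ℝ) : 0 ≤ φ p := (hrange ⟨p, rfl⟩).1
  have h1 (p : ℝ × ℝ) : 0 ≤ 1 - φ p := sub_nonneg.2 (hrange ⟨p, rfl⟩).2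
  set Ω : Set (ℝ × ℝ × ℝ) := ({q : ℝ × ℝ × ℝ | (q.1, q.2.1) ∈ Xp ∧ -1 ≤ q.2.2} ∪
    {q : ℝ × ℝ × ℝ | (q.1, q.2.1) ∈ Xm ∧ q.2.2 ≤ 1})ᶜ with hΩ
  let a : ℝ × ℝ × ℝ → ℝ := fun q => φ (q.1, q.2.1)
  let v : ℝ × ℝ × ℝ → ℝ := fun q => q.2.2 - (2 * a q - 1)
  let s : ℝ × ℝ × ℝ → ℝ := fun q => √(v q ^ 2 + 4 * (a q * (1 - a q)))
  let f : ℝ × ℝ × ℝ → ℝ × ℝ × ℝ := fun q =>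
    (q.1, q.2.1, log ((s q + v q + 2 * (1 - a q)) / (s q - v q + 2 * a q)))
  let g : ℝ × ℝ × ℝ → ℝ × ℝ × ℝ := fun q =>
    (q.1, q.2.1, a q * exp q.2.2 - (1 - a q) / exp q.2.2 + (2 * a q - 1))
  have ha : ContDiff ℝ (⊤ : ℕ∞) a := hφ.comp (by fun_prop)
  have hv : ContDiff ℝ (⊤ : ℕ∞) v := by fun_prop
  have hmem (q : ℝ × ℝ × ℝ) : q ∈ Ω ↔ (a q = 0 → v q < 0) ∧ (1 - a q = 0 → 0 < v q) := by
    simp only [hΩ, mem_compl_iff, mem_union, mem_ofPred_eq, hp, hm, not_or, not_and, not_le]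
    refine and_congr (forall_congr' fun h => ?_) ⟨fun H h => ?_, fun H h => ?_⟩
    · have : a q = 0 := h
      simp only [v, this]
      constructor <;> intro <;> linarith
    · have h' : a q = 1 := by linarith
      have := H h'
      simp only [v, h']
      linarith
    · have h' : a q = 1 := h
      have := H (by linarith)
      simp only [v, h'] at this
      linarith
  have hpos (q : ℝ × ℝ × ℝ) (hq : q ∈ Ω) :=
    discrim_pos_and_root_terms_pos (h0 (q.1, q.2.1)) (h1 (q.1, q.2.1))
      ((hmem q).1 hq).1 ((hmem q).1 hq).2
  have hvg (q : ℝ × ℝ × ℝ) : v (g q) = a q * exp q.2.2 - (1 - a q) / exp q.2.2 :=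
    add_sub_cancel_right _ _
  have hgΩ (q : ℝ × ℝ × ℝ) : g q ∈ Ω := by
    rw [hmem, hvg, show a (g q) = a q from rfl]
    refine ⟨fun h => ?_, fun h => ?_⟩
    · simp [h, exp_pos]
    · have h' : a q = 1 := by linarith
      simp [h', exp_pos]
  have hfg (q : ℝ × ℝ × ℝ) : f (g q) = q := by
    refine Prod.ext rfl (Prod.ext rfl ?_)
    simp only [f, s, hvg, show a (g q) = a q from rfl]
    rw [div_eq_of_sqrt_discrim (h0 _) (h1 _) (by ring_nf; norm_num) (exp_pos _), log_exp]
  have hgf (q : ℝ × ℝ × ℝ) (hq : q ∈ Ω) : g (f q) = q := by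
    obtain ⟨hD, hN, hM⟩ := hpos q hq
    refine Prod.ext rfl (Prod.ext rfl ?_)
    change a q * exp (log _) - (1 - a q) / exp (log _) + (2 * a q - 1) = _
    rw [exp_log (div_pos hN hM), mul_div_sub_div_eq_of_sq_eq (sq_sqrt hD.le) hN.ne' hM.ne']
    exact sub_add_cancel _ _
  refine ⟨?_, f, g, ⟨fun _ _ => mem_univ _, fun x hx y hy hxy => ?_,
    fun q _ => ⟨g q, hgΩ q, hfg q⟩⟩, ?_, ?_, hgf, hfg⟩
  · have hc : Continuous fun q : ℝ × ℝ × ℝ => (q.1, q.2.1) := by fun_prop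
    have hz : Continuous fun q : ℝ × ℝ × ℝ => q.2.2 := by fun_prop
    exact (((hXp.preimage hc).inter (isClosed_le continuous_const hz)).union
      ((hXm.preimage hc).inter (isClosed_le hz continuous_const))).isOpen_compl
  · rw [← hgf x hx, ← hgf y hy, hxy]
  · have hs : ContDiffOn ℝ (⊤ : ℕ∞) s Ω :=
      ContDiffOn.sqrt (by fun_prop) fun q hq => (hpos q hq).1.ne'
    refine contDiff_fst.contDiffOn.prodMk (ContDiffOn.prodMk (by fun_prop) (ContDiffOn.log
      (ContDiffOn.div (by fun_prop) (by fun_prop) fun q hq => (hpos q hq).2.2.ne') fun q hq => ?_))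
    exact (div_pos (hpos q hq).2.1 (hpos q hq).2.2).ne'
  · exact contDiff_fst.prodMk (ContDiff.prodMk (by fun_prop)
      (((ha.mul (by fun_prop)).sub (ContDiff.div (by fun_prop) (by fun_prop)
        fun q => (exp_pos _).ne')).add (by fun_prop)))
end
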